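/- arXiv:2403.13977 — 7 statements merged into one kernel-verified Lean document; each statement's English description precedes it below -/
import Mathlib

section
/- For every integer l ≥ 1 and p = 2l+1, the set of all 2-element subsets (pairs) of {1, 2, …, p} can be partitioned into p blocks G_1, …, G_p such that for each k ∈ {1, …, p} the block G_k consists of exactly l pairs, no pair in G_k contains the index k, and the pairs in G_k are pairwise disjoint (so every index other than k occurs in exactly one pair of G_k). -/
theorem bijective_add_self_of_odd_card {α : Type*} [AddCommGroup α] [Fintype α]
    (h : Odd (Fintype.card α)) :
    Function.Bijective fun x : α => x + x := by
  have hc : (Nat.card α).Coprime 2 := by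
    rw [Nat.card_eq_fintype_card]
    exact h.coprime_two_right
  simpa only [two_nsmul] using hc.nsmul_right_bijective

section PairsWithMidpoint

variable {α : Type*} [AddCommGroup α] [Fintype α] [DecidableEq α]

/-- The 2-element subsets of an abelian group whose elements sum to `k + k`. -/
def pairsWithMidpoint (k : α) : Finset (Finset α) :=
  Finset.univ.filter fun e => e.card = 2 ∧ ∑ x ∈ e, x = k + k

theorem mem_pairsWithMidpoint {k : α} {e : Finset α} :
    e ∈ pairsWithMidpoint k ↔ e.card = 2 ∧ ∑ x ∈ e, x = k + k := by
  simp [pairsWithMidpoint]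

theorem eq_pair_of_mem_pairsWithMidpoint {k j : α} {e : Finset α}
    (he : e ∈ pairsWithMidpoint k) (hj : j ∈ e) : j ≠ k + k - j ∧ e = {j, k + k - j} := by
  obtain ⟨hc, hs⟩ := mem_pairsWithMidpoint.1 he
  obtain ⟨a, b, hab, rfl⟩ := Finset.card_eq_two.1 hc
  rw [Finset.sum_pair hab] at hs
  rw [← hs]
  rcases Finset.mem_insert.1 hj with rfl | hj
  · simpa using hab
  · obtain rfl := Finset.mem_singleton.1 hj
    simpa [Finset.pair_comm] using hab.symm

theorem notMem_of_mem_pairsWithMidpoint {k : α} {e : Finset α}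
    (he : e ∈ pairsWithMidpoint k) : k ∉ e := fun hk =>
  (eq_pair_of_mem_pairsWithMidpoint he hk).1 (by simp)

theorem pairwise_disjoint_pairsWithMidpoint (k : α) :
    (↑(pairsWithMidpoint k) : Set (Finset α)).Pairwise fun e f => Disjoint e f := by
  intro e he f hf hef
  refine Finset.disjoint_left.2 fun j hje hjf => hef ?_
  rw [(eq_pair_of_mem_pairsWithMidpoint he hje).2, (eq_pair_of_mem_pairsWithMidpoint hf hjf).2]

theorem existsUnique_mem_pairsWithMidpoint_mem (h : Odd (Fintype.card α)) {k j : α}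
    (hj : j ≠ k) : ∃! e, e ∈ pairsWithMidpoint k ∧ j ∈ e := by
  have hne : j ≠ k + k - j := fun hjk =>
    hj ((bijective_add_self_of_odd_card h).injective (eq_sub_iff_add_eq.1 hjk))
  refine ⟨{j, k + k - j}, ⟨mem_pairsWithMidpoint.2 ⟨Finset.card_pair hne, ?_⟩, by simp⟩,
    fun e he => (eq_pair_of_mem_pairsWithMidpoint he.1 he.2).2⟩
  rw [Finset.sum_pair hne, add_sub_cancel]

theorem existsUnique_mem_pairsWithMidpoint (h : Odd (Fintype.card α)) {e : Finset α}
    (he : e.card = 2) : ∃! k, e ∈ pairsWithMidpoint k := by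
  simpa only [mem_pairsWithMidpoint, he, true_and, eq_comm] using
    (bijective_add_self_of_odd_card h).existsUnique (∑ x ∈ e, x)

theorem card_pairsWithMidpoint_mul_two (h : Odd (Fintype.card α)) (k : α) :
    (pairsWithMidpoint k).card * 2 = Fintype.card α - 1 := by
  have hU : (pairsWithMidpoint k).biUnion (fun e => e) = Finset.univ.erase k := by
    ext j
    simp only [Finset.mem_biUnion, Finset.mem_erase, Finset.mem_univ, and_true]
    constructor
    · rintro ⟨e, he, hj⟩ rfl
      exact notMem_of_mem_pairsWithMidpoint he hj
    · exact fun hj => (existsUnique_mem_pairsWithMidpoint_mem h hj).exists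
  rw [← Finset.card_univ, ← Finset.card_erase_of_mem (Finset.mem_univ k), ← hU,
    Finset.card_biUnion (pairwise_disjoint_pairsWithMidpoint k),
    Finset.sum_const_nat fun e he => (mem_pairsWithMidpoint.1 he).1]

end PairsWithMidpoint

/-- For every integer `l ≥ 1` and `p = 2l+1`, the 2-element subsets of `{1,…,p}`
(modelled as `Fin (2l+1)`) can be partitioned into `p` blocks `G k` such that each
block consists of exactly `l` pairwise disjoint pairs, none of which contains `k`;
consequently every index other than `k` occurs in exactly one pair of `G k`. -/
theorem odd_partition_of_pairs (l : ℕ) (hl : 1 ≤ l) :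
    ∃ G : Fin (2 * l + 1) → Finset (Finset (Fin (2 * l + 1))),
      (∀ k, (G k).card = l) ∧
      (∀ k, ∀ e ∈ G k, e.card = 2 ∧ k ∉ e) ∧
      (∀ k, (↑(G k) : Set (Finset (Fin (2 * l + 1)))).Pairwise
        (fun e f => Disjoint e f)) ∧
      (∀ k, ∀ j : Fin (2 * l + 1), j ≠ k → ∃! e, e ∈ G k ∧ j ∈ e) ∧
      (∀ e : Finset (Fin (2 * l + 1)), e.card = 2 → ∃! k, e ∈ G k) := by
  have h : Odd (Fintype.card (Fin (2 * l + 1))) := by simp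
  refine ⟨pairsWithMidpoint, fun k => ?_,
    fun k e he => ⟨(mem_pairsWithMidpoint.1 he).1, notMem_of_mem_pairsWithMidpoint he⟩,
    pairwise_disjoint_pairsWithMidpoint,
    fun k j hj => existsUnique_mem_pairsWithMidpoint_mem h hj,
    fun e he => existsUnique_mem_pairsWithMidpoint h he⟩
  have hk := card_pairsWithMidpoint_mul_two h k
  rw [Fintype.card_fin] at hk
  omega
end

section
/- Let A and B be bounded self-adjoint operators on a complex Hilbert space with ⟨Af, f⟩ ≤ 0 for all f, and let 0 < σ ≤ σ′. If the spectrum of A + σB contains a positive number, then the spectrum of A + σ′B also contains a positive number. -/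
theorem IsSelfAdjoint.nonpos_iff_forall_pos_notMem_spectrum {H : Type*} [NormedAddCommGroup H]
    [InnerProductSpace ℂ H] [CompleteSpace H] {T : H →L[ℂ] H} (hT : IsSelfAdjoint T) :
    T ≤ 0 ↔ ∀ r : ℝ, 0 < r → (r : ℂ) ∉ spectrum ℂ T := by
  have key := le_algebraMap_iff_spectrum_le (r := (0 : ℝ)) (a := T) hT
  rw [map_zero] at key
  rw [key]
  have hmem (r : ℝ) : (r : ℂ) ∈ spectrum ℂ T ↔ r ∈ spectrum ℝ T :=
    spectrum.algebraMap_mem_iff (R := ℝ) ℂ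
  simp only [hmem]
  exact ⟨fun h r hr hrT ↦ (h r hrT).not_gt hr, fun h r hrT ↦ not_lt.1 fun hr ↦ h r hr hrT⟩

/-- Monotonicity in the coupling constant: if `A` and `B` are bounded self-adjoint
operators with `⟨Af, f⟩ ≤ 0` for all `f`, and `0 < σ ≤ σ'`, then positivity of some
point of the spectrum of `A + σB` implies the same for `A + σ'B`. -/
theorem positive_spectrum_monotone_in_coupling {H : Type*} [NormedAddCommGroup H]
    [InnerProductSpace ℂ H] [CompleteSpace H]
    (A B : H →L[ℂ] H) (hA : IsSelfAdjoint A) (hB : IsSelfAdjoint B)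
    (hAneg : ∀ f : H, (inner (𝕜 := ℂ) (A f) f).re ≤ 0)
    (σ σ' : ℝ) (hσ : 0 < σ) (hσ' : σ ≤ σ')
    (h : ∃ lam : ℝ, 0 < lam ∧ (lam : ℂ) ∈ spectrum ℂ (A + ((σ : ℝ) : ℂ) • B)) :
    ∃ lam : ℝ, 0 < lam ∧ (lam : ℂ) ∈ spectrum ℂ (A + ((σ' : ℝ) : ℂ) • B) := by
  have hsa (s : ℝ) : IsSelfAdjoint (A + (s : ℂ) • B) :=
    hA.add (.smul (isSelfAdjoint_iff.2 (Complex.conj_ofReal s)) hB)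
  have hA0 : 0 ≤ -A := by
    rw [ContinuousLinearMap.nonneg_iff_isPositive, ContinuousLinearMap.isPositive_def']
    refine ⟨hA.neg, fun f ↦ ?_⟩
    simpa [ContinuousLinearMap.reApplyInnerSelf_apply] using hAneg f
  by_contra! hcon
  obtain ⟨r, hr, hrT⟩ := h
  refine (hsa σ).nonpos_iff_forall_pos_notMem_spectrum.1 ?_ r hr hrT
  have h' : 0 ≤ -(A + (σ' : ℂ) • B) :=
    neg_nonneg.2 ((hsa σ').nonpos_iff_forall_pos_notMem_spectrum.2 hcon)
  have hσ'0 : 0 < σ' := hσ.trans_le hσ'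
  have hne : (σ' : ℂ) ≠ 0 := mod_cast hσ'0.ne'
  have hid : -(A + (σ : ℂ) • B) =
      ((1 - σ / σ' : ℝ) : ℂ) • (-A) + ((σ / σ' : ℝ) : ℂ) • (-(A + (σ' : ℂ) • B)) := by
    push_cast
    match_scalars
    · field_simp
      ring
    · field_simp
  rw [← neg_nonneg, hid, ContinuousLinearMap.nonneg_iff_isPositive]
  rw [ContinuousLinearMap.nonneg_iff_isPositive] at hA0 h'
  refine (hA0.smul_of_nonneg ?_).add (h'.smul_of_nonneg ?_)
  · exact Complex.zero_le_real.2 (sub_nonneg.2 ((div_le_one hσ'0).2 hσ'))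
  · exact Complex.zero_le_real.2 (div_pos hσ hσ'0).le
end

section
/- Let V : ℤ^d → ℝ tend to 0 at infinity and suppose V(x₀) > 0 for some x₀ ∈ ℤ^d. Then there exists σ* > 0 such that for every σ > σ* the operator H = 𝓛 + σV on ℓ²(ℤ^d) (where (Hf)(x) = (𝓛f)(x) + σV(x)f(x)) has a positive eigenvalue: there exist λ > 0 and a nonzero ψ ∈ ℓ²(ℤ^d) with Hψ = λψ. -/
open scoped InnerProductSpace ENNReal lp

section HilbertSpace

variable {E : Type*} [NormedAddCommGroup E] [InnerProductSpace ℂ E] [CompleteSpace E]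

/-- A self-adjoint operator whose numerical range exceeds `c` has spectrum above `c`. -/
lemma exists_mem_spectrum_gt_of_lt_re_inner {B : E →L[ℂ] E} (hB : IsSelfAdjoint B) {c : ℝ}
    {u : E} (hu : c * ‖u‖ ^ 2 < (⟪B u, u⟫_ℂ).re) :
    ∃ lam : ℝ, c < lam ∧ (lam : ℂ) ∈ spectrum ℂ B := by
  have hsa : IsSelfAdjoint (algebraMap ℝ (E →L[ℂ] E) c - B) :=
    (IsSelfAdjoint.algebraMap _ (IsSelfAdjoint.all c)).sub hB
  have hneg : ¬ 0 ≤ algebraMap ℝ (E →L[ℂ] E) c - B := by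
    rw [ContinuousLinearMap.nonneg_iff_isPositive]
    intro h
    have h1 := h.re_inner_nonneg_left u
    have h2 : (⟪(algebraMap ℝ (E →L[ℂ] E) c - B) u, u⟫_ℂ).re
        = c * ‖u‖ ^ 2 - (⟪B u, u⟫_ℂ).re := by
      rw [Algebra.algebraMap_eq_smul_one]
      simp only [sub_apply, smul_apply,
        one_apply_eq_self, inner_sub_left, Complex.sub_re, inner_smul_left_eq_smul]
      rw [Complex.smul_re, smul_eq_mul, inner_self_eq_norm_sq_to_K]
      norm_cast
    rw [RCLike.re_to_complex, h2] at h1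
    linarith
  rw [StarOrderedRing.nonneg_iff_spectrum_nonneg (R := ℝ) _ hsa] at hneg
  push Not at hneg
  obtain ⟨x, hx, hx0⟩ := hneg
  refine ⟨c - x, by linarith, ?_⟩
  have hmem : c - x ∈ spectrum ℝ B := by
    rw [spectrum.mem_iff] at hx ⊢
    rwa [← IsUnit.neg_iff, map_sub, show -(algebraMap ℝ (E →L[ℂ] E) c - algebraMap ℝ _ x - B)
      = algebraMap ℝ _ x - (algebraMap ℝ _ c - B) by abel]
  exact (spectrum.algebraMap_mem_iff ℂ).2 hmem

/-- A compact perturbation of `A` only adds eigenvalues to the spectrum outside the closed disc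
of radius `‖A‖`. -/
lemma exists_eigenvector_of_mem_spectrum_add {A K : E →L[ℂ] E} (hK : IsCompactOperator K)
    {μ : ℂ} (hμ : ‖A‖ < ‖μ‖) (hspec : μ ∈ spectrum ℂ (A + K)) :
    ∃ ψ : E, ψ ≠ 0 ∧ (A + K) ψ = μ • ψ := by
  have hA : IsUnit (algebraMap ℂ (E →L[ℂ] E) μ - A) :=
    spectrum.mem_resolventSet_of_norm_lt_mul
      ((mul_le_of_le_one_right (norm_nonneg _) ContinuousLinearMap.norm_id_le).trans_lt hμ)
  obtain ⟨R, hR⟩ := hA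
  have hcomp : IsCompactOperator ((↑R⁻¹ : E →L[ℂ] E) * K) := hK.clm_comp _
  have hfactor : algebraMap ℂ (E →L[ℂ] E) μ - (A + K)
      = R * (algebraMap ℂ (E →L[ℂ] E) 1 - (↑R⁻¹ : E →L[ℂ] E) * K) := by
    rw [mul_sub, Units.mul_inv_cancel_left, map_one, mul_one, hR]
    abel
  rcases hcomp.hasEigenvalue_or_mem_resolventSet one_ne_zero with h | h
  · obtain ⟨ψ, hψ⟩ := h.exists_hasEigenvector
    refine ⟨ψ, hψ.2, ?_⟩
    have h1 : (↑R⁻¹ : E →L[ℂ] E) (K ψ) = ψ := by simpa using hψ.apply_eq_smul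
    have h2 : (R : E →L[ℂ] E) ψ = K ψ := by
      conv_lhs => rw [← h1]
      rw [← mul_apply_eq_comp, Units.mul_inv, one_apply_eq_self]
    rw [hR, sub_apply, Algebra.algebraMap_eq_smul_one] at h2
    rw [add_apply, ← h2]
    simp
  · refine absurd ?_ hspec
    rw [spectrum.mem_resolventSet_iff, hfactor]
    exact R.isUnit.mul h

end HilbertSpace

section Sequences

variable {ι : Type*}

lemma lp.norm_le_mul_norm {f g : lp (fun _ : ι => ℂ) 2} {C : ℝ} (hC : 0 ≤ C)
    (h : ∀ i, ‖g i‖ ≤ C * ‖f i‖) : ‖g‖ ≤ C * ‖f‖ := by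
  have h1 : ‖g‖ ≤ ‖(C : ℂ) • f‖ := lp.norm_mono two_ne_zero fun i => by
    rw [lp.coeFn_smul, Pi.smul_apply, norm_smul, Complex.norm_real, Real.norm_of_nonneg hC]
    exact h i
  rwa [norm_smul, Complex.norm_real, Real.norm_of_nonneg hC] at h1

/-- Multiplication by a bounded function, as an operator on `ℓ²`. -/
noncomputable def lp.mulCLM (v : lp (fun _ : ι => ℂ) ∞) :
    lp (fun _ : ι => ℂ) 2 →L[ℂ] lp (fun _ : ι => ℂ) 2 :=
  LinearMap.mkContinuous
    { toFun := fun f => ⟨fun i => v i * f i,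
        ((lp.memℓp f).norm.const_mul ‖v‖).mono fun i => by
          rw [norm_mul]
          exact mul_le_mul_of_nonneg_right (lp.norm_apply_le_norm ENNReal.top_ne_zero v i)
            (norm_nonneg _)⟩
      map_add' := fun f g => by ext i; exact mul_add _ _ _
      map_smul' := fun c f => by ext i; exact mul_left_comm _ _ _ }
    ‖v‖ fun f => lp.norm_le_mul_norm (norm_nonneg _) fun i => by
      change ‖v i * f i‖ ≤ _
      rw [norm_mul]
      exact mul_le_mul_of_nonneg_right (lp.norm_apply_le_norm ENNReal.top_ne_zero v i)
        (norm_nonneg _)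

lemma lp.mulCLM_apply (v : lp (fun _ : ι => ℂ) ∞) (f : lp (fun _ : ι => ℂ) 2) (i : ι) :
    lp.mulCLM v f i = v i * f i := rfl

lemma lp.isSelfAdjoint_mulCLM {v : lp (fun _ : ι => ℂ) ∞} (hv : ∀ i, star (v i) = v i) :
    IsSelfAdjoint (lp.mulCLM v) := by
  rw [ContinuousLinearMap.isSelfAdjoint_iff_isSymmetric]
  intro f g
  change ⟪lp.mulCLM v f, g⟫_ℂ = ⟪f, lp.mulCLM v g⟫_ℂ
  simp_rw [lp.inner_eq_tsum, lp.mulCLM_apply]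
  refine tsum_congr fun i => ?_
  simp only [RCLike.inner_apply, map_mul]
  rw [starRingEnd_apply, hv]
  ring

/-- Multiplication by a function vanishing at infinity is a compact operator on `ℓ²`. -/
lemma lp.isCompactOperator_mulCLM {v : lp (fun _ : ι => ℂ) ∞}
    (hv : ∀ ε : ℝ, 0 < ε → {i | ε ≤ ‖v i‖}.Finite) : IsCompactOperator (lp.mulCLM v) := by
  classical
  let T (s : Finset ι) : lp (fun _ : ι => ℂ) 2 →L[ℂ] lp (fun _ : ι => ℂ) 2 :=
    ∑ j ∈ s, v j • (lp.singleContinuousLinearMap ℂ (fun _ : ι => ℂ) 2 j).comp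
      (lp.evalCLM ℂ (fun _ : ι => ℂ) 2 j)
  have hT (s : Finset ι) : IsCompactOperator (T s) := by
    refine (compactOperator (RingHom.id ℂ) _ _).sum_mem fun j _ => ?_
    refine Submodule.smul_mem _ _ ?_
    exact (isCompactOperator_of_locallyCompactSpace_dom
      (lp.evalCLM ℂ (fun _ : ι => ℂ) 2 j)).clm_comp
      (lp.singleContinuousLinearMap ℂ (fun _ : ι => ℂ) 2 j)
  have hT_apply (s : Finset ι) (f : lp (fun _ : ι => ℂ) 2) (i : ι) :
      T s f i = if i ∈ s then v i * f i else 0 := by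
    have h : lp.evalCLM ℂ (fun _ : ι => ℂ) 2 i (T s f)
        = ∑ j ∈ s, v j * lp.single (E := fun _ : ι => ℂ) 2 j (f j) i := by
      rw [sum_apply, map_sum]
      rfl
    refine h.trans ?_
    simp [Pi.single_apply]
  refine isClosed_setOfPred_isCompactOperator.closure_subset
    (Metric.mem_closure_iff.2 fun ε hε => ?_)
  refine ⟨T (hv (ε / 2) (half_pos hε)).toFinset, hT _, ?_⟩
  rw [dist_eq_norm]
  refine lt_of_le_of_lt (ContinuousLinearMap.opNorm_le_bound _ (half_pos hε).le fun f =>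
    lp.norm_le_mul_norm (half_pos hε).le fun i => ?_) (half_lt_self hε)
  rw [sub_apply, lp.coeFn_sub, Pi.sub_apply, lp.mulCLM_apply, hT_apply]
  by_cases hi : ε / 2 ≤ ‖v i‖
  · have hi' : i ∈ (hv (ε / 2) (half_pos hε)).toFinset := by simpa using hi
    rw [if_pos hi', sub_self]
    exact (_root_.norm_zero (E := ℂ)).trans_le (by positivity)
  · have hi' : i ∉ (hv (ε / 2) (half_pos hε)).toFinset := by simpa using hi
    rw [if_neg hi', sub_zero, norm_mul]
    exact mul_le_mul_of_nonneg_right (not_le.1 hi).le (norm_nonneg _)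

end Sequences

section Translation

variable {G : Type*} [AddCommGroup G]

lemma lp.memℓp_translation (z : G) (f : lp (fun _ : G => ℂ) 2) :
    Memℓp (fun x => f (x + z)) 2 := by
  have h : Summable fun x => ‖f x‖ ^ (2 : ℝ≥0∞).toReal := (lp.memℓp f).summable (by norm_num)
  exact memℓp_gen (h.comp_injective (Equiv.addRight z).injective)

lemma lp.norm_translation (z : G) (f : lp (fun _ : G => ℂ) 2) :
    ‖(⟨_, lp.memℓp_translation z f⟩ : lp (fun _ : G => ℂ) 2)‖ = ‖f‖ := by
  rw [lp.norm_eq_tsum_rpow (by norm_num), lp.norm_eq_tsum_rpow (by norm_num)]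
  congr 1
  exact (Equiv.addRight z).tsum_eq fun x => ‖f x‖ ^ (2 : ℝ≥0∞).toReal

/-- Translation by `z`, as an operator on `ℓ²`. -/
noncomputable def lp.translation (z : G) :
    lp (fun _ : G => ℂ) 2 →L[ℂ] lp (fun _ : G => ℂ) 2 :=
  LinearMap.mkContinuous
    { toFun := fun f => ⟨_, lp.memℓp_translation z f⟩
      map_add' := fun _ _ => rfl
      map_smul' := fun _ _ => rfl }
    1 fun f => (lp.norm_translation z f).trans_le (one_mul _).ge

lemma lp.translation_apply (z : G) (f : lp (fun _ : G => ℂ) 2) (x : G) :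
    lp.translation z f x = f (x + z) := rfl

lemma lp.norm_translation_le (z : G) : ‖lp.translation z‖ ≤ 1 :=
  LinearMap.mkContinuous_norm_le _ zero_le_one _

lemma lp.star_translation (z : G) : star (lp.translation z) = lp.translation (-z) := by
  rw [ContinuousLinearMap.star_eq_adjoint, eq_comm, ContinuousLinearMap.eq_adjoint_iff]
  intro f g
  simp_rw [lp.inner_eq_tsum, lp.translation_apply]
  rw [← (Equiv.addRight z).tsum_eq]
  simp

/-- The averaging operator `f ↦ ∑ z, a z • f (· + z)` on `ℓ²`. -/
noncomputable def lp.average (a : G → ℝ) :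
    lp (fun _ : G => ℂ) 2 →L[ℂ] lp (fun _ : G => ℂ) 2 :=
  ∑' z, (a z : ℂ) • lp.translation z

variable {a : G → ℝ}

lemma lp.norm_smul_translation_le (hpos : ∀ z, 0 ≤ a z) (z : G) :
    ‖(a z : ℂ) • lp.translation z‖ ≤ a z := by
  rw [norm_smul, Complex.norm_real, Real.norm_of_nonneg (hpos z)]
  exact mul_le_of_le_one_right (hpos z) (lp.norm_translation_le z)

lemma lp.norm_average_le (hpos : ∀ z, 0 ≤ a z) (hsum : Summable a) :
    ‖lp.average a‖ ≤ ∑' z, a z :=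
  tsum_of_norm_bounded hsum.hasSum (lp.norm_smul_translation_le hpos)

lemma lp.isSelfAdjoint_average (hsymm : ∀ z, a (-z) = a z) : IsSelfAdjoint (lp.average a) := by
  rw [IsSelfAdjoint, lp.average, tsum_star, ← (Equiv.neg G).tsum_eq]
  simp [star_smul, lp.star_translation, hsymm]

lemma lp.hasSum_average_apply (hpos : ∀ z, 0 ≤ a z) (hsum : Summable a)
    (f : lp (fun _ : G => ℂ) 2) (x : G) :
    HasSum (fun z => (a z : ℂ) * f (x + z)) (lp.average a f x) := by
  have h := (Summable.of_norm_bounded hsum (lp.norm_smul_translation_le hpos)).hasSum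
  exact (h.mapL (ContinuousLinearMap.apply ℂ (lp (fun _ : G => ℂ) 2) f)).mapL
    (lp.evalCLM ℂ (fun _ : G => ℂ) 2 x)

end Translation


/-- If `V : ℤ^d → ℝ` vanishes at infinity and is positive at some point `x₀`, then
for all sufficiently large coupling constants `σ` the Schrödinger operator
`H = 𝓛 + σV` on `ℓ²(ℤ^d)` has a positive eigenvalue. -/
theorem positive_eigenvalue_for_large_coupling (d : ℕ) (hd : 1 ≤ d)
    (a : (Fin d → ℤ) → ℝ)
    (hsymm : ∀ z, a (-z) = a z) (hpos : ∀ z, 0 ≤ a z) (ha0 : a 0 = 0)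
    (hsum : Summable a) (hnorm : ∑' z, a z = 1)
    (L : lp (fun _ : Fin d → ℤ => ℂ) 2 →L[ℂ] lp (fun _ : Fin d → ℤ => ℂ) 2)
    (hL : ∀ f : lp (fun _ : Fin d → ℤ => ℂ) 2, ∀ x,
        L f x = ∑' z, (a z : ℂ) * (f (x + z) - f x))
    (V : (Fin d → ℤ) → ℝ)
    (hV : ∀ ε : ℝ, 0 < ε → {x : Fin d → ℤ | ε ≤ |V x|}.Finite)
    (x₀ : Fin d → ℤ) (hV₀ : 0 < V x₀) :
    ∃ σstar : ℝ, 0 < σstar ∧ ∀ σ : ℝ, σstar < σ →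
      ∃ lam : ℝ, 0 < lam ∧
        ∃ ψ : lp (fun _ : Fin d → ℤ => ℂ) 2, ψ ≠ 0 ∧
          ∀ x, L ψ x + (σ : ℂ) * (V x : ℂ) * ψ x = (lam : ℂ) * ψ x := by
  refine ⟨2 / V x₀, by positivity, fun σ hσ => ?_⟩
  have hAL (f : lp (fun _ : Fin d → ℤ => ℂ) 2) (x : Fin d → ℤ) :
      lp.average a f x = L f x + f x := by
    have h1 := lp.hasSum_average_apply hpos hsum f x
    have h2 : HasSum (fun z => (a z : ℂ) * f x) (f x) := by
      simpa [hnorm] using (Complex.hasSum_ofReal.2 hsum.hasSum).mul_right (f x)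
    rw [hL]
    simp_rw [mul_sub]
    rw [(h1.sub h2).tsum_eq, sub_add_cancel]
  have hAnorm : ‖lp.average a‖ ≤ 1 := hnorm ▸ lp.norm_average_le hpos hsum
  have hVmem : Memℓp (fun x => (σ : ℂ) * (V x : ℂ)) ∞ := by
    refine Memℓp.const_mul (memℓp_infty ?_) _
    refine (((hV 1 one_pos).image fun x => ‖(V x : ℂ)‖).bddAbove.union
      (bddAbove_Iic (a := 1))).mono ?_
    rintro _ ⟨x, rfl⟩
    by_cases hx : 1 ≤ |V x|
    · exact Or.inl ⟨x, hx, rfl⟩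
    · exact Or.inr (by simpa using (not_le.1 hx).le)
  have hσ0 : 0 < σ := lt_trans (by positivity) hσ
  let v : lp (fun _ : Fin d → ℤ => ℂ) ∞ := ⟨_, hVmem⟩
  have hv (x : Fin d → ℤ) : v x = (σ : ℂ) * (V x : ℂ) := rfl
  have hK : IsCompactOperator (lp.mulCLM v) := lp.isCompactOperator_mulCLM fun ε hε => by
    refine (hV (ε / σ) (by positivity)).subset fun x hx => ?_
    rw [Set.mem_ofPred_eq, hv, norm_mul, Complex.norm_real, Complex.norm_real,
      Real.norm_of_nonneg hσ0.le, Real.norm_eq_abs] at hx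
    rwa [Set.mem_ofPred_eq, div_le_iff₀' hσ0]
  have hB : IsSelfAdjoint (lp.average a + lp.mulCLM v) :=
    (lp.isSelfAdjoint_average hsymm).add (lp.isSelfAdjoint_mulCLM fun x => by simp [hv])
  let δ : lp (fun _ : Fin d → ℤ => ℂ) 2 := lp.single 2 x₀ (1 : ℂ)
  have hδ : ‖δ‖ = 1 := by simp [δ, lp.norm_single]
  have hlarge : 1 * ‖δ‖ ^ 2 < (⟪(lp.average a + lp.mulCLM v) δ, δ⟫_ℂ).re := by
    have h1 : -1 ≤ (⟪lp.average a δ, δ⟫_ℂ).re := by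
      refine neg_le_of_abs_le ((Complex.abs_re_le_norm _).trans ((norm_inner_le_norm _ _).trans ?_))
      rw [hδ, mul_one]
      simpa [hδ] using (lp.average a).le_of_opNorm_le hAnorm δ
    have h2 : (⟪lp.mulCLM v δ, δ⟫_ℂ).re = σ * V x₀ := by
      rw [lp.inner_single_right, lp.mulCLM_apply, hv]
      simp [δ]
    rw [div_lt_iff₀ hV₀] at hσ
    rw [add_apply, inner_add_left, Complex.add_re, h2, hδ]
    linarith
  obtain ⟨lam, hlam, hspec⟩ := exists_mem_spectrum_gt_of_lt_re_inner hB hlarge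
  obtain ⟨ψ, hψ, heq⟩ := exists_eigenvector_of_mem_spectrum_add hK
    (hAnorm.trans_lt (by simpa using hlam.trans_le (le_abs_self lam))) hspec
  refine ⟨lam - 1, by linarith, ψ, hψ, fun x => ?_⟩
  have hx : lp.average a ψ x + lp.mulCLM v ψ x = lam * ψ x := congrArg (fun f => f x) heq
  rw [hAL, lp.mulCLM_apply, hv] at hx
  push_cast
  linear_combination hx
end

section
/- Assume the recurrence condition ∫_{[−π,π]^d} (1 − â(k))^{−1} dk = +∞ and the finiteness condition J := ∫_{[−π,π]^d} |k| (1 − â(k))^{−1} dk < ∞, where â(k) = Σ_{z∈ℤ^d} a(z) cos(⟨k,z⟩). Let V : ℤ^d → ℝ satisfy Σ_{x∈ℤ^d} (1 + |x|)|V(x)| < ∞ and Σ_{x∈ℤ^d} V(x) > 0, and set σ₀ = (2 J Σ_{x∈ℤ^d} |x||V(x)|)^{−1}. Then for every σ with 0 < σ < σ₀, the operator H = 𝓛 + σV on ℓ²(ℤ^d), (Hf)(x) = (𝓛f)(x) + σV(x)f(x), has exactly one positive eigenvalue (counted with multiplicity): there is exactly one λ > 0 admitting a nonzero ψ ∈ ℓ²(ℤ^d)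 with Hψ = λψ, and its eigenspace is one-dimensional. -/
open MeasureTheory

theorem ContinuousLinearMap.exists_pos_mem_spectrum {E : Type*} [NormedAddCommGroup E]
    [InnerProductSpace ℂ E] [CompleteSpace E] {T : E →L[ℂ] E} (hT : IsSelfAdjoint T) {x : E}
    (hx : 0 < (inner ℂ (T x) x).re) : ∃ r : ℝ, 0 < r ∧ r ∈ spectrum ℝ T := by
  by_contra! h
  have hneg : 0 ≤ -T := by
    rw [StarOrderedRing.nonneg_iff_spectrum_nonneg (R := ℝ) (-T) hT.neg]
    intro r hr
    rw [← spectrum.neg_eq, Set.mem_neg] at hr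
    by_contra! hlt
    exact h (-r) (by linarith) hr
  rw [ContinuousLinearMap.nonneg_iff_isPositive] at hneg
  have := hneg.2 x
  simp [ContinuousLinearMap.reApplyInnerSelf] at this
  linarith

theorem ContinuousLinearMap.isUnit_algebraMap_sub {E : Type*} [NormedAddCommGroup E]
    [InnerProductSpace ℂ E] [CompleteSpace E] {L : E →L[ℂ] E} (hL : (-L).IsPositive) {r : ℝ}
    (hr : 0 < r) : IsUnit (algebraMap ℝ (E →L[ℂ] E) r - L) := by
  by_contra h
  have hmem : r ∈ spectrum ℝ L := h
  rw [← neg_neg L, ← spectrum.neg_eq, Set.mem_neg] at hmem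
  have := spectrum_nonneg_of_nonneg ((ContinuousLinearMap.nonneg_iff_isPositive _).2 hL) hmem
  linarith

theorem ContinuousLinearMap.exists_eigenvector_add_compact {E : Type*} [NormedAddCommGroup E]
    [InnerProductSpace ℂ E] [CompleteSpace E] {L K : E →L[ℂ] E} (hL : (-L).IsPositive)
    (hK : IsCompactOperator K) {r : ℝ} (hr : 0 < r) (hspec : r ∈ spectrum ℝ (L + K)) :
    ∃ ψ : E, ψ ≠ 0 ∧ (L + K) ψ = (r : ℂ) • ψ := by
  obtain ⟨u, hu⟩ := ContinuousLinearMap.isUnit_algebraMap_sub hL hr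
  have hc : IsCompactOperator ((u⁻¹ : (E →L[ℂ] E)ˣ).val * K) := hK.clm_comp _
  rcases hc.hasEigenvalue_or_mem_resolventSet one_ne_zero with h | h
  · obtain ⟨ψ, hψ⟩ := h.exists_hasEigenvector
    refine ⟨ψ, hψ.2, ?_⟩
    have h1 : (u⁻¹ : (E →L[ℂ] E)ˣ).val (K ψ) = ψ := by simpa using hψ.apply_eq_smul
    have h2 : K ψ = u.val ψ := by
      rw [← congrArg u.val h1, ← mul_apply_eq_comp, Units.mul_inv, one_apply_eq_self]
    rw [add_apply, h2, hu]
    simp [Algebra.algebraMap_eq_smul_one]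
  · exfalso
    rw [spectrum.mem_resolventSet_iff, map_one] at h
    refine hspec ?_
    have := u.isUnit.mul h
    rw [mul_sub, mul_one, ← mul_assoc, Units.mul_inv, one_mul, hu] at this
    rwa [sub_sub] at this

theorem ContinuousLinearMap.IsPositive.norm_inner_apply_sq_le {E : Type*} [NormedAddCommGroup E]
    [InnerProductSpace ℂ E] {T : E →L[ℂ] E} (hT : T.IsPositive) (x y : E) :
    ‖inner ℂ (T x) y‖ ^ 2 ≤ (inner ℂ (T x) x).re * (inner ℂ (T y) y).re := by
  let c : PreInnerProductSpace.Core ℂ E :=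
    { inner := fun x y => inner ℂ (T x) y
      conj_inner_symm := fun x y => by
        rw [inner_conj_symm]
        exact (hT.isSymmetric x y).symm
      re_inner_nonneg := fun x => hT.2 x
      add_left := fun x y z => by simp
      smul_left := fun x y r => by simp [mul_comm] }
  have := @InnerProductSpace.Core.inner_mul_inner_self_le ℂ E _ _ _ c x y
  have h2 : ‖inner ℂ (T y) x‖ = ‖inner ℂ (T x) y‖ := by
    rw [show inner ℂ (T y) x = inner ℂ y (T x) from hT.isSymmetric y x, norm_inner_symm]
  rw [sq]
  change ‖inner ℂ (T x) y‖ * ‖inner ℂ (T y) x‖ ≤ _ at this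
  rw [h2] at this
  exact this

/-- The translation operator `(shift z f) x = f (x + z)` on `ℓ²(G)`. -/
noncomputable def shift {G : Type*} [AddCommGroup G] (z : G) :
    lp (fun _ : G => ℂ) 2 →L[ℂ] lp (fun _ : G => ℂ) 2 :=
  LinearMap.mkContinuous
    { toFun := fun f => ⟨fun x => f (x + z), by
        refine memℓp_gen ?_
        exact ((lp.memℓp f).summable (by norm_num)).comp_injective (add_left_injective z)⟩
      map_add' := fun f g => rfl
      map_smul' := fun c f => rfl } 1 (fun f => by
      have h2 : 0 < (2 : ENNReal).toReal := by norm_num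
      rw [one_mul]
      refine le_of_eq ?_
      rw [lp.norm_eq_tsum_rpow h2, lp.norm_eq_tsum_rpow h2]
      congr 1
      exact (Equiv.addRight z).tsum_eq fun x => ‖f x‖ ^ (2 : ENNReal).toReal)

@[simp]
theorem shift_apply {G : Type*} [AddCommGroup G] (z : G) (f : lp (fun _ : G => ℂ) 2) (x : G) :
    shift z f x = f (x + z) := rfl

theorem norm_shift_le {G : Type*} [AddCommGroup G] (z : G) : ‖shift z‖ ≤ 1 :=
  LinearMap.mkContinuous_norm_le _ zero_le_one _

theorem inner_shift_left {G : Type*} [AddCommGroup G] (z : G) (f g : lp (fun _ : G => ℂ) 2) :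
    inner ℂ (shift z f) g = inner ℂ f (shift (-z) g) := by
  rw [lp.inner_eq_tsum, lp.inner_eq_tsum, ← (Equiv.addRight z).tsum_eq fun x =>
    inner ℂ (f x) (shift (-z) g x)]
  simp

theorem hasSum_generator {G : Type*} [AddCommGroup G] {a : G → ℝ} (ha : ∀ z, 0 ≤ a z)
    (hsum : Summable a) {L : lp (fun _ : G => ℂ) 2 →L[ℂ] lp (fun _ : G => ℂ) 2}
    (hL : ∀ f : lp (fun _ : G => ℂ) 2, ∀ x, L f x = ∑' z, (a z : ℂ) * (f (x + z) - f x)) :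
    HasSum (fun z => (a z : ℂ) • (shift z - 1)) L := by
  have hs : Summable fun z => (a z : ℂ) • (shift z - 1) := by
    refine Summable.of_norm_bounded (hsum.mul_left 2) fun z => ?_
    rw [norm_smul, Complex.norm_real, Real.norm_of_nonneg (ha z), mul_comm]
    refine mul_le_mul_of_nonneg_right ?_ (ha z)
    have h1 : ‖(1 : lp (fun _ : G => ℂ) 2 →L[ℂ] lp (fun _ : G => ℂ) 2)‖ ≤ 1 :=
      ContinuousLinearMap.norm_id_le
    linarith [norm_sub_le (shift z) 1, norm_shift_le z]
  convert hs.hasSum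
  ext f x
  rw [hL]
  have h := (hs.hasSum.mapL (ContinuousLinearMap.apply ℂ (lp (fun _ : G => ℂ) 2) f)).mapL
    (lp.evalCLM ℂ (fun _ : G => ℂ) 2 x)
  exact h.tsum_eq

theorem isPositive_neg_generator {G : Type*} [AddCommGroup G] {a : G → ℝ}
    (hsymm : ∀ z, a (-z) = a z) (ha : ∀ z, 0 ≤ a z)
    (hsum : Summable a) {L : lp (fun _ : G => ℂ) 2 →L[ℂ] lp (fun _ : G => ℂ) 2}
    (hL : ∀ f : lp (fun _ : G => ℂ) 2, ∀ x, L f x = ∑' z, (a z : ℂ) * (f (x + z) - f x)) :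
    (-L).IsPositive := by
  have hS := hasSum_generator ha hsum hL
  have hright : ∀ f g, HasSum (fun z => (a z : ℂ) * (inner ℂ f (shift z g) - inner ℂ f g))
      (inner ℂ f (L g)) := fun f g => by
    have h := (hS.mapL (ContinuousLinearMap.apply ℂ (lp (fun _ : G => ℂ) 2) g)).mapL
      (innerSL ℂ f)
    simpa [inner_smul_right, inner_sub_right] using h
  have hsym : ∀ f g, inner ℂ (L f) g = inner ℂ f (L g) := fun f g => by
    have h1 := (hright f g)
    have h2 := (Complex.hasSum_conj'.2 (hright g f))
    rw [inner_conj_symm] at h2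
    rw [← (Equiv.neg G).hasSum_iff] at h2
    refine h2.unique ?_
    convert h1 using 2 with z
    simp [hsymm, inner_conj_symm, inner_shift_left]
  refine ⟨fun f g => by simpa using hsym f g, fun f => ?_⟩
  have h1 := Complex.hasSum_re (hright f f)
  have h2 : (inner ℂ f (L f)).re ≤ 0 := by
    refine h1.nonpos fun z => ?_
    rw [Complex.re_ofReal_mul]
    refine mul_nonpos_of_nonneg_of_nonpos (ha z) ?_
    rw [Complex.sub_re, sub_nonpos]
    refine (Complex.re_le_norm _).trans ((norm_inner_le_norm _ _).trans ?_)
    have h3 := (shift z).le_of_opNorm_le (norm_shift_le z) f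
    have h4 : (inner ℂ f f).re = ‖f‖ * ‖f‖ := inner_self_eq_norm_mul_norm (𝕜 := ℂ) f
    rw [h4]
    gcongr
    simpa using h3
  simpa [ContinuousLinearMap.reApplyInnerSelf, hsym] using h2

/-- The unit vector of `ℓ²(G)` supported at `x`. -/
noncomputable def delta {G : Type*} [DecidableEq G] (x : G) : lp (fun _ : G => ℂ) 2 :=
  lp.single 2 x 1

theorem delta_apply {G : Type*} [DecidableEq G] (x y : G) :
    delta x y = if y = x then 1 else 0 := by
  simp [delta, Pi.single_apply]

theorem norm_delta {G : Type*} [DecidableEq G] (x : G) : ‖delta x‖ = 1 := by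
  simp [delta, lp.norm_single]

theorem inner_delta_left {G : Type*} [DecidableEq G] (x : G) (f : lp (fun _ : G => ℂ) 2) :
    inner ℂ (delta x) f = f x := by
  simp [delta, lp.inner_single_left]

/-- The operator of multiplication by the summable potential `V` on `ℓ²(G)`. -/
noncomputable def potential {G : Type*} [DecidableEq G] (V : G → ℝ) :
    lp (fun _ : G => ℂ) 2 →L[ℂ] lp (fun _ : G => ℂ) 2 :=
  ∑' x, (V x : ℂ) • InnerProductSpace.rankOne ℂ (delta x) (delta x)

theorem hasSum_potential {G : Type*} [DecidableEq G] {V : G → ℝ} (hV : Summable fun x => |V x|) :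
    HasSum (fun x => (V x : ℂ) • InnerProductSpace.rankOne ℂ (delta x) (delta x))
      (potential V) := by
  refine (Summable.of_norm_bounded hV fun x => ?_).hasSum
  rw [norm_smul, InnerProductSpace.norm_rankOne, norm_delta]
  simp

theorem isCompactOperator_potential {G : Type*} [DecidableEq G] {V : G → ℝ}
    (hV : Summable fun x => |V x|) : IsCompactOperator (potential V) := by
  refine isCompactOperator_of_tendsto (hasSum_potential hV)
    (Filter.Eventually.of_forall fun s => ?_)
  induction s using Finset.induction_on with
  | empty => simpa using isCompactOperator_zero
  | insert x s hx ih =>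
    rw [Finset.sum_insert hx]
    refine IsCompactOperator.add ?_ ih
    refine IsCompactOperator.smul ?_ _
    have h : IsCompactOperator (innerSL ℂ (delta x)) :=
      isCompactOperator_of_locallyCompactSpace_dom _
    exact h.clm_comp (ContinuousLinearMap.toSpanSingleton ℂ (delta x))

theorem potential_apply {G : Type*} [DecidableEq G] {V : G → ℝ} (hV : Summable fun x => |V x|)
    (f : lp (fun _ : G => ℂ) 2) (x : G) : potential V f x = V x * f x := by
  have h := ((hasSum_potential hV).mapL
    (ContinuousLinearMap.apply ℂ (lp (fun _ : G => ℂ) 2) f)).mapL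
    (lp.evalCLM ℂ (fun _ : G => ℂ) 2 x)
  refine h.unique ?_
  convert hasSum_single x ?_ using 1
  · change _ = (V x : ℂ) * (inner ℂ (delta x) f * delta x x)
    simp [inner_delta_left, delta_apply]
  · intro y hy
    change (V y : ℂ) * (inner ℂ (delta y) f * delta y x) = 0
    simp [delta_apply, hy.symm]

theorem hasSum_inner_potential {G : Type*} [DecidableEq G] {V : G → ℝ}
    (hV : Summable fun x => |V x|) (f g : lp (fun _ : G => ℂ) 2) :
    HasSum (fun x => (V x : ℂ) * inner ℂ (f x) (g x)) (inner ℂ (potential V f) g) := by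
  refine (lp.hasSum_inner (potential V f) g).congr_fun fun x => ?_
  rw [potential_apply hV]
  simp
  ring

theorem isSelfAdjoint_potential {G : Type*} [DecidableEq G] {V : G → ℝ}
    (hV : Summable fun x => |V x|) : IsSelfAdjoint (potential V) := by
  rw [ContinuousLinearMap.isSelfAdjoint_iff_isSymmetric]
  intro f g
  refine (hasSum_inner_potential hV f g).unique ?_
  refine (lp.hasSum_inner f (potential V g)).congr_fun fun x => ?_
  rw [potential_apply hV]
  simp
  ring

/-- The pairing of a momentum `k` with a lattice vector `z`. -/
noncomputable def pairing {d : ℕ} (k : Fin d → ℝ) (z : Fin d → ℤ) : ℝ := ∑ i, k i * (z i : ℝ)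

theorem continuous_pairing {d : ℕ} (z : Fin d → ℤ) : Continuous fun k => pairing k z := by
  unfold pairing
  fun_prop

theorem pairing_add {d : ℕ} (k : Fin d → ℝ) (z w : Fin d → ℤ) :
    pairing k (z + w) = pairing k z + pairing k w := by
  simp [pairing, mul_add, Finset.sum_add_distrib]

theorem pairing_neg {d : ℕ} (k : Fin d → ℝ) (z : Fin d → ℤ) :
    pairing k (-z) = -pairing k z := by
  simp [pairing]

theorem abs_pairing_le {d : ℕ} (k : Fin d → ℝ) (z : Fin d → ℤ) :
    |pairing k z| ≤ Real.sqrt (∑ i, (k i) ^ 2) * Real.sqrt (∑ i, ((z i : ℝ)) ^ 2) := by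
  rw [← Real.sqrt_mul (Finset.sum_nonneg fun i _ => sq_nonneg _)]
  exact Real.abs_le_sqrt (Finset.sum_mul_sq_le_sq_mul_sq _ _ _)

theorem volume_pairing_eq {d : ℕ} {z : Fin d → ℤ} (hz : z ≠ 0) (c : ℝ) :
    volume {k : Fin d → ℝ | pairing k z = c} = 0 := by
  obtain ⟨i, hi⟩ := Function.ne_iff.1 hz
  have hi' : (z i : ℝ) ≠ 0 := by simpa using hi
  let l : (Fin d → ℝ) →ₗ[ℝ] ℝ := ∑ j, (z j : ℝ) • LinearMap.proj j
  have hl : ∀ k, l k = pairing k z := fun k => by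
    simp [l, pairing, mul_comm]
  have hker : LinearMap.ker l ≠ ⊤ := by
    intro h
    have h1 : Pi.single i (1 : ℝ) ∈ LinearMap.ker l := h ▸ Submodule.mem_top
    rw [LinearMap.mem_ker, hl] at h1
    simp [pairing, Pi.single_apply, hi'] at h1
  have h0 := Measure.addHaar_submodule (volume : Measure (Fin d → ℝ)) _ hker
  have hset : {k : Fin d → ℝ | pairing k z = c} =
      (fun k => k + Pi.single i (-(c / z i))) ⁻¹' (LinearMap.ker l : Set (Fin d → ℝ)) := by
    ext k
    have h2 : l (Pi.single i (-(c / z i))) = -c := by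
      rw [hl]
      simp [pairing, Pi.single_apply, hi']
    rw [Set.mem_preimage, SetLike.mem_coe, LinearMap.mem_ker, map_add, h2, hl]
    exact sub_eq_zero.symm
  rw [hset, measure_preimage_add_right, h0]

theorem integral_exp_mul_I_int (n : ℤ) :
    ∫ t in Set.Icc (-Real.pi) Real.pi, Complex.exp (t * n * Complex.I) =
      if n = 0 then 2 * (Real.pi : ℂ) else 0 := by
  rw [integral_Icc_eq_integral_Ioc,
    ← intervalIntegral.integral_of_le (by linarith [Real.pi_pos])]
  split_ifs with h
  · subst h
    simp
    ring
  · have hc : (n : ℂ) * Complex.I ≠ 0 := by simp [h]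
    have h1 : ∀ t : ℝ, Complex.exp (t * n * Complex.I) = Complex.exp (n * Complex.I * t) :=
      fun t => by ring_nf
    simp_rw [h1]
    rw [integral_exp_mul_complex hc]
    have h2 : Complex.exp (n * Complex.I * (Real.pi : ℝ)) =
        Complex.exp (n * Complex.I * (-Real.pi : ℝ)) := by
      rw [Complex.exp_eq_exp_iff_exists_int]
      exact ⟨n, by push_cast; ring⟩
    rw [h2, sub_self, zero_div]

/-- The Brillouin zone `[-π, π]^d`. -/
def box (d : ℕ) : Set (Fin d → ℝ) := Set.Icc (fun _ => -Real.pi) (fun _ => Real.pi)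

theorem isCompact_box (d : ℕ) : IsCompact (box d) := isCompact_Icc

theorem integral_cos_box {d : ℕ} (w : Fin d → ℤ) :
    ∫ k in box d, Real.cos (pairing k w) = if w = 0 then (2 * Real.pi) ^ d else 0 := by
  have h1 : ∫ k in box d, Complex.exp (pairing k w * Complex.I) =
      ∏ i : Fin d, if w i = 0 then 2 * (Real.pi : ℂ) else 0 := by
    rw [box, ← Set.pi_univ_Icc, volume_pi, Measure.restrict_pi_pi]
    simp_rw [← integral_exp_mul_I_int]
    rw [← integral_fintype_prod_eq_prod (fun i (t : ℝ) => Complex.exp (t * w i * Complex.I))]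
    refine integral_congr_ae (Filter.Eventually.of_forall fun k => ?_)
    simp [pairing, ← Complex.exp_sum, Finset.sum_mul]
  have hexp_int : IntegrableOn (fun k => Complex.exp (pairing k w * Complex.I)) (box d) := by
    refine ContinuousOn.integrableOn_compact (isCompact_box d) (Continuous.continuousOn ?_)
    have := continuous_pairing w
    fun_prop
  have h2 : ∫ k in box d, Real.cos (pairing k w) =
      (∫ k in box d, Complex.exp (pairing k w * Complex.I)).re := by
    rw [← Complex.reCLM_apply, ← ContinuousLinearMap.integral_comp_comm _ hexp_int]
    simp [Complex.exp_ofReal_mul_I_re]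
  rw [h2, h1]
  split_ifs with h
  · subst h
    have : (∏ i : Fin d, if (0 : Fin d → ℤ) i = 0 then 2 * (Real.pi : ℂ) else 0) =
      (((2 * Real.pi) ^ d : ℝ) : ℂ) := by simp
    rw [this, Complex.ofReal_re]
  · obtain ⟨i, hi⟩ := Function.ne_iff.1 h
    rw [Finset.prod_eq_zero (Finset.mem_univ i) (if_neg hi), Complex.zero_re]

/-- The Fourier symbol `∑ a(z) cos⟨k, z⟩` of the jump kernel. -/
noncomputable def symbol {d : ℕ} (a : (Fin d → ℤ) → ℝ) (k : Fin d → ℝ) : ℝ :=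
  ∑' z, a z * Real.cos (pairing k z)

theorem abs_mul_cos_le {r : ℝ} (hr : 0 ≤ r) (t : ℝ) : ‖r * Real.cos t‖ ≤ r := by
  rw [Real.norm_eq_abs, abs_mul, abs_of_nonneg hr]
  exact mul_le_of_le_one_right hr (Real.abs_cos_le_one t)

theorem summable_symbol {d : ℕ} {a : (Fin d → ℤ) → ℝ} (hpos : ∀ z, 0 ≤ a z) (hsum : Summable a)
    (k : Fin d → ℝ) : Summable fun z => a z * Real.cos (pairing k z) :=
  Summable.of_norm_bounded hsum fun z => abs_mul_cos_le (hpos z) _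

theorem continuous_symbol {d : ℕ} {a : (Fin d → ℤ) → ℝ} (hpos : ∀ z, 0 ≤ a z)
    (hsum : Summable a) : Continuous (symbol a) := by
  refine continuous_tsum (fun z => ?_) hsum fun z k => abs_mul_cos_le (hpos z) _
  have := continuous_pairing z
  fun_prop

theorem symbol_le_one {d : ℕ} {a : (Fin d → ℤ) → ℝ} (hpos : ∀ z, 0 ≤ a z) (hsum : Summable a)
    (hnorm : ∑' z, a z = 1) (k : Fin d → ℝ) : symbol a k ≤ 1 := by
  rw [← hnorm]
  exact (summable_symbol hpos hsum k).tsum_le_tsum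
    (fun z => (le_abs_self _).trans (abs_mul_cos_le (hpos z) _)) hsum

theorem ae_symbol_lt_one {d : ℕ} {a : (Fin d → ℤ) → ℝ} (hpos : ∀ z, 0 ≤ a z) (ha0 : a 0 = 0)
    (hsum : Summable a) (hnorm : ∑' z, a z = 1) :
    ∀ᵐ k : Fin d → ℝ, symbol a k < 1 := by
  obtain ⟨z, hz⟩ : ∃ z, a z ≠ 0 := by
    by_contra! h
    simp [h] at hnorm
  have hz0 : z ≠ 0 := by
    rintro rfl
    exact hz ha0
  have hnull : ∀ n : ℤ, ∀ᵐ k : Fin d → ℝ, pairing k z ≠ n * (2 * Real.pi) := fun n => by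
    rw [ae_iff]
    simpa using volume_pairing_eq hz0 _
  filter_upwards [ae_all_iff.2 hnull] with k hk
  refine lt_of_le_of_ne (symbol_le_one hpos hsum hnorm k) fun h => ?_
  have h1 := hsum.hasSum.sub (summable_symbol hpos hsum k).hasSum
  rw [hnorm, ← symbol, h, sub_self] at h1
  have h2 := (hasSum_zero_iff_of_nonneg fun w => ?_).1 h1
  · have h3 : a z * (1 - Real.cos (pairing k z)) = 0 := by
      rw [mul_sub, mul_one]
      exact congrFun h2 z
    have h4 : Real.cos (pairing k z) = 1 := by
      have := (mul_eq_zero.1 h3).resolve_left hz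
      linarith
    obtain ⟨n, hn⟩ := (Real.cos_eq_one_iff _).1 h4
    exact hk n hn.symm
  · have := (le_abs_self _).trans (abs_mul_cos_le (hpos w) (pairing k w))
    simpa using this

theorem hasSum_mul_cos_add {d : ℕ} {a : (Fin d → ℤ) → ℝ} (hsymm : ∀ z, a (-z) = a z)
    (hpos : ∀ z, 0 ≤ a z) (hsum : Summable a) (k : Fin d → ℝ) (w : Fin d → ℤ) :
    HasSum (fun z => a z * Real.cos (pairing k (w + z)))
      (symbol a k * Real.cos (pairing k w)) := by
  have hsin : Summable fun z => a z * Real.sin (pairing k z) :=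
    Summable.of_norm_bounded hsum fun z => by
      rw [Real.norm_eq_abs, abs_mul, abs_of_nonneg (hpos z)]
      exact mul_le_of_le_one_right (hpos z) (Real.abs_sin_le_one _)
  have hsin0 : ∑' z, a z * Real.sin (pairing k z) = 0 := by
    have h := (Equiv.neg (Fin d → ℤ)).tsum_eq fun z => a z * Real.sin (pairing k z)
    simp [hsymm, pairing_neg, tsum_neg] at h
    linarith
  have h1 := ((summable_symbol hpos hsum k).hasSum.mul_right (Real.cos (pairing k w))).sub
    (hsin.hasSum.mul_right (Real.sin (pairing k w)))
  rw [hsin0, zero_mul, sub_zero] at h1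
  refine h1.congr_fun fun z => ?_
  rw [pairing_add, Real.cos_add]
  ring

/-- The lattice Green function of the random walk at spectral parameter `r`. -/
noncomputable def green {d : ℕ} (a : (Fin d → ℤ) → ℝ) (r : ℝ) (w : Fin d → ℤ) : ℝ :=
  ((2 * Real.pi) ^ d)⁻¹ * ∫ k in box d, Real.cos (pairing k w) / (r + 1 - symbol a k)

theorem denom_pos {d : ℕ} {a : (Fin d → ℤ) → ℝ} (hpos : ∀ z, 0 ≤ a z) (hsum : Summable a)
    (hnorm : ∑' z, a z = 1) {r : ℝ} (hr : 0 < r) (k : Fin d → ℝ) : 0 < r + 1 - symbol a k := by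
  linarith [symbol_le_one hpos hsum hnorm k]

theorem integrableOn_green {d : ℕ} {a : (Fin d → ℤ) → ℝ} (hpos : ∀ z, 0 ≤ a z)
    (hsum : Summable a) (hnorm : ∑' z, a z = 1) {r : ℝ} (hr : 0 < r) (w : Fin d → ℤ) :
    IntegrableOn (fun k => Real.cos (pairing k w) / (r + 1 - symbol a k)) (box d) := by
  refine ContinuousOn.integrableOn_compact (isCompact_box d) (Continuous.continuousOn ?_)
  have h1 := continuous_pairing w
  have h2 := continuous_symbol hpos hsum
  exact (Real.continuous_cos.comp h1).div (continuous_const.sub h2)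
    fun k => (denom_pos hpos hsum hnorm hr k).ne'

theorem hasSum_mul_green_add {d : ℕ} {a : (Fin d → ℤ) → ℝ} (hsymm : ∀ z, a (-z) = a z)
    (hpos : ∀ z, 0 ≤ a z) (hsum : Summable a) (hnorm : ∑' z, a z = 1) {r : ℝ} (hr : 0 < r)
    (w : Fin d → ℤ) :
    HasSum (fun z => a z * green a r (w + z))
      ((r + 1) * green a r w - if w = 0 then 1 else 0) := by
  have hI := hasSum_integral_of_dominated_convergence (μ := volume.restrict (box d))
    (F := fun z k => a z * (Real.cos (pairing k (w + z)) / (r + 1 - symbol a k)))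
    (f := fun k => (r + 1) * (Real.cos (pairing k w) / (r + 1 - symbol a k)) -
      Real.cos (pairing k w)) (fun z _ => a z * r⁻¹)
    (fun z => ((integrableOn_green hpos hsum hnorm hr (w + z)).const_mul _).aestronglyMeasurable)
    (fun z => Filter.Eventually.of_forall fun k => by
      rw [norm_mul, Real.norm_of_nonneg (hpos z)]
      refine mul_le_mul_of_nonneg_left ?_ (hpos z)
      rw [norm_div, Real.norm_of_nonneg (denom_pos hpos hsum hnorm hr k).le, inv_eq_one_div]
      exact div_le_div₀ zero_le_one (Real.abs_cos_le_one _) hr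
        (by linarith [symbol_le_one hpos hsum hnorm k]))
    (Filter.Eventually.of_forall fun k => hsum.mul_right _)
    (by
      have := (isCompact_box d).measure_lt_top (μ := volume)
      exact integrableOn_const this.ne)
    (Filter.Eventually.of_forall fun k => by
      have hD := (denom_pos hpos hsum hnorm hr k).ne'
      have h := (hasSum_mul_cos_add hsymm hpos hsum k w).div_const (r + 1 - symbol a k)
      have he : (r + 1) * (Real.cos (pairing k w) / (r + 1 - symbol a k)) -
          Real.cos (pairing k w) = symbol a k * Real.cos (pairing k w) / (r + 1 - symbol a k) := by
        field_simp
        ring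
      rw [he]
      exact h.congr_fun fun z => (mul_div_assoc _ _ _).symm)
  have hc : ((2 * Real.pi) ^ d) ≠ 0 := by positivity
  have hcos : IntegrableOn (fun k => Real.cos (pairing k w)) (box d) := by
    refine ContinuousOn.integrableOn_compact (isCompact_box d) (Continuous.continuousOn ?_)
    exact Real.continuous_cos.comp (continuous_pairing w)
  rw [integral_sub ((integrableOn_green hpos hsum hnorm hr w).const_mul _) hcos,
    integral_const_mul, integral_cos_box] at hI
  have hJ := hI.mul_left ((2 * Real.pi) ^ d)⁻¹
  have hval : ((r + 1) * green a r w - if w = 0 then 1 else 0) = ((2 * Real.pi) ^ d)⁻¹ *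
      ((r + 1) * (∫ k in box d, Real.cos (pairing k w) / (r + 1 - symbol a k)) -
        if w = 0 then (2 * Real.pi) ^ d else 0) := by
    rw [green, mul_sub]
    split_ifs with h
    · rw [inv_mul_cancel₀ hc]
      ring
    · ring
  rw [hval]
  refine hJ.congr_fun fun z => ?_
  rw [integral_const_mul, green]
  ring

theorem abs_green_le {d : ℕ} {a : (Fin d → ℤ) → ℝ} (hpos : ∀ z, 0 ≤ a z)
    (hsum : Summable a) (hnorm : ∑' z, a z = 1) {r : ℝ} (hr : 0 < r) (w : Fin d → ℤ) :
    |green a r w| ≤ green a r 0 := by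
  rw [green, green, abs_mul, abs_of_pos (by positivity : 0 < ((2 * Real.pi) ^ d)⁻¹)]
  refine mul_le_mul_of_nonneg_left ?_ (by positivity)
  rw [← Real.norm_eq_abs]
  refine norm_integral_le_of_norm_le (integrableOn_green hpos hsum hnorm hr 0)
    (Filter.Eventually.of_forall fun k => ?_)
  have hD := denom_pos hpos hsum hnorm hr k
  rw [norm_div, Real.norm_of_nonneg hD.le]
  gcongr
  simpa [pairing] using Real.abs_cos_le_one _

theorem eq_zero_of_bounded_of_hasSum {G : Type*} [AddCommGroup G] {a : G → ℝ}
    (hpos : ∀ z, 0 ≤ a z) (hsum : HasSum a 1) {r : ℝ} (hr : 0 < r) {u : G → ℂ} {C : ℝ}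
    (hC : ∀ x, ‖u x‖ ≤ C) (hu : ∀ x, HasSum (fun z => (a z : ℂ) * u (x + z)) ((r + 1) * u x)) :
    u = 0 := by
  have hbdd : BddAbove (Set.range fun x => ‖u x‖) := ⟨C, by rintro _ ⟨x, rfl⟩; exact hC x⟩
  set M := ⨆ x, ‖u x‖
  have hM : ∀ x, ‖u x‖ ≤ M := fun x => le_ciSup hbdd x
  have hstep : ∀ x, (r + 1) * ‖u x‖ ≤ M := fun x => by
    have h1 : ‖((r + 1) * u x : ℂ)‖ ≤ 1 * M := by
      rw [← (hu x).tsum_eq]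
      refine tsum_of_norm_bounded (hsum.mul_right M) fun z => ?_
      rw [norm_mul, Complex.norm_real, Real.norm_of_nonneg (hpos z)]
      exact mul_le_mul_of_nonneg_left (hM _) (hpos z)
    rw [norm_mul, one_mul] at h1
    have h2 : ‖(r + 1 : ℂ)‖ = r + 1 := by
      rw [show (r + 1 : ℂ) = ((r + 1 : ℝ) : ℂ) by push_cast; rfl, Complex.norm_real,
        Real.norm_of_nonneg (by linarith)]
    rwa [h2] at h1
  have hM0 : M ≤ M / (r + 1) := ciSup_le fun x => by
    rw [le_div_iff₀ (by linarith)]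
    linarith [hstep x]
  have hM1 : M ≤ 0 := by
    rw [le_div_iff₀ (by linarith)] at hM0
    nlinarith
  ext x
  exact norm_le_zero_iff.1 ((hM x).trans hM1)

theorem resolvent_delta_apply {d : ℕ} {a : (Fin d → ℤ) → ℝ} (hsymm : ∀ z, a (-z) = a z)
    (hpos : ∀ z, 0 ≤ a z) (hsum : Summable a) (hnorm : ∑' z, a z = 1)
    {L : lp (fun _ : Fin d → ℤ => ℂ) 2 →L[ℂ] lp (fun _ : Fin d → ℤ => ℂ) 2}
    (hL : ∀ f : lp (fun _ : Fin d → ℤ => ℂ) 2, ∀ x,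
      L f x = ∑' z, (a z : ℂ) * (f (x + z) - f x)) {r : ℝ} (hr : 0 < r) {y : Fin d → ℤ}
    {g : lp (fun _ : Fin d → ℤ => ℂ) 2} (hg : (r : ℂ) • g - L g = delta y) (x : Fin d → ℤ) :
    g x = green a r (x - y) := by
  have hgbd : ∀ x, ‖g x‖ ≤ ‖g‖ := fun x => lp.norm_apply_le_norm two_ne_zero g x
  have hg1 : ∀ x, HasSum (fun z => (a z : ℂ) * g (x + z))
      ((r + 1) * g x - if x = y then 1 else 0) := fun x => by
    have hs : Summable fun z => (a z : ℂ) * g (x + z) :=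
      Summable.of_norm_bounded (hsum.mul_right ‖g‖) fun z => by
        rw [norm_mul, Complex.norm_real, Real.norm_of_nonneg (hpos z)]
        exact mul_le_mul_of_nonneg_left (hgbd _) (hpos z)
    have ha : HasSum (fun z => (a z : ℂ)) 1 := by
      have := Complex.hasSum_ofReal.2 hsum.hasSum
      rwa [hnorm, Complex.ofReal_one] at this
    have h1 := (hs.hasSum.sub (ha.mul_right (g x)))
    have h2 : L g x = (∑' z, (a z : ℂ) * g (x + z)) - 1 * g x := by
      rw [hL, ← h1.tsum_eq]
      simp_rw [mul_sub]
    have h3 : (r : ℂ) * g x - L g x = if x = y then 1 else 0 := by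
      rw [← delta_apply, ← hg]
      rfl
    convert hs.hasSum using 1
    rw [h2] at h3
    linear_combination h3
  have hu := eq_zero_of_bounded_of_hasSum hpos (hnorm ▸ hsum.hasSum) hr
    (u := fun x => g x - green a r (x - y)) (C := ‖g‖ + green a r 0) (fun x => ?_) fun x => ?_
  · exact sub_eq_zero.1 (congrFun hu x)
  · refine (norm_sub_le _ _).trans (add_le_add (hgbd x) ?_)
    rw [Complex.norm_real]
    exact abs_green_le hpos hsum hnorm hr _
  · have h1 := Complex.hasSum_ofReal.2
      (hasSum_mul_green_add hsymm hpos hsum hnorm hr (x - y))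
    have hval : (r + 1) * (g x - green a r (x - y)) =
        ((r + 1) * g x - if x = y then 1 else 0) -
          (((r + 1) * green a r (x - y) - if x - y = 0 then 1 else 0 : ℝ) : ℂ) := by
      simp only [sub_eq_zero]
      split_ifs <;> push_cast <;> ring
    rw [hval]
    refine ((hg1 x).sub h1).congr_fun fun z => ?_
    push_cast
    rw [mul_sub, sub_add_eq_add_sub]

theorem green_zero_sub_green_le {d : ℕ} {a : (Fin d → ℤ) → ℝ} (hpos : ∀ z, 0 ≤ a z)
    (ha0 : a 0 = 0) (hsum : Summable a) (hnorm : ∑' z, a z = 1)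
    (hJint : IntegrableOn (fun k : Fin d → ℝ => Real.sqrt (∑ i, (k i) ^ 2) * (1 - symbol a k)⁻¹)
      (box d)) {r : ℝ} (hr : 0 < r) (w : Fin d → ℤ) :
    green a r 0 - green a r w ≤
      (∫ k in box d, Real.sqrt (∑ i, (k i) ^ 2) * (1 - symbol a k)⁻¹) *
        Real.sqrt (∑ i, ((w i : ℝ)) ^ 2) := by
  have hc : ((2 * Real.pi) ^ d)⁻¹ ≤ 1 :=
    inv_le_one_of_one_le₀ (one_le_pow₀ (by linarith [Real.pi_gt_three]))
  have h0 := integrableOn_green hpos hsum hnorm hr 0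
  have hw := integrableOn_green hpos hsum hnorm hr w
  have hle : ∫ k in box d, (Real.cos (pairing k 0) / (r + 1 - symbol a k) -
        Real.cos (pairing k w) / (r + 1 - symbol a k)) ≤
      ∫ k in box d, Real.sqrt (∑ i, (k i) ^ 2) * (1 - symbol a k)⁻¹ *
        Real.sqrt (∑ i, ((w i : ℝ)) ^ 2) := by
    refine integral_mono_ae (h0.sub hw) (hJint.mul_const _) ?_
    filter_upwards [ae_restrict_of_ae (ae_symbol_lt_one hpos ha0 hsum hnorm)] with k hk
    have hD := denom_pos hpos hsum hnorm hr k
    have h1 : (0 : ℝ) < 1 - symbol a k := by linarith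
    have hcos : 1 - Real.cos (pairing k w) ≤ |pairing k w| := by
      have := Real.abs_cos_sub_cos_le (pairing k w) 0
      rw [Real.cos_zero, sub_zero, abs_sub_comm] at this
      exact (le_abs_self _).trans this
    have h2 := hcos.trans (abs_pairing_le k w)
    have hz : pairing k 0 = 0 := by simp [pairing]
    rw [hz, Real.cos_zero, ← sub_div, mul_right_comm, ← div_eq_mul_inv]
    exact div_le_div₀ (by positivity) h2 h1 (by linarith)
  rw [integral_sub h0 hw, integral_mul_const] at hle
  have hnn : 0 ≤ ∫ k in box d, Real.sqrt (∑ i, (k i) ^ 2) * (1 - symbol a k)⁻¹ :=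
    integral_nonneg fun k => mul_nonneg (Real.sqrt_nonneg _)
      (inv_nonneg.2 (sub_nonneg.2 (symbol_le_one hpos hsum hnorm k)))
  rw [green, green, ← mul_sub]
  refine (mul_le_mul_of_nonneg_left hle (by positivity)).trans ?_
  exact mul_le_of_le_one_left (mul_nonneg hnn (Real.sqrt_nonneg _)) hc

theorem tendsto_green_zero {d : ℕ} {a : (Fin d → ℤ) → ℝ} (hpos : ∀ z, 0 ≤ a z)
    (hsum : Summable a) (hnorm : ∑' z, a z = 1)
    (hrec : ∫⁻ k in box d, ENNReal.ofReal ((1 - symbol a k)⁻¹) = ⊤)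
    {r : ℕ → ℝ} (hr : ∀ n, 0 < r n) (hr0 : Filter.Tendsto r Filter.atTop (nhds 0)) :
    Filter.Tendsto (fun n => green a (r n) 0) Filter.atTop Filter.atTop := by
  have hmeas : Measurable (symbol a) := (continuous_symbol hpos hsum).measurable
  have h1 : ∫⁻ k in box d, ENNReal.ofReal ((1 - symbol a k)⁻¹) ≤
      Filter.liminf (fun n => ∫⁻ k in box d, ENNReal.ofReal ((r n + 1 - symbol a k)⁻¹))
        Filter.atTop := by
    refine le_trans (lintegral_mono fun k => ?_) (lintegral_liminf_le fun n => ?_)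
    · rcases eq_or_ne (1 - symbol a k) 0 with h | h
      · simp [h]
      · have ht : Filter.Tendsto (fun n => ENNReal.ofReal ((r n + 1 - symbol a k)⁻¹))
            Filter.atTop (nhds (ENNReal.ofReal ((1 - symbol a k)⁻¹))) := by
          refine ENNReal.tendsto_ofReal (Filter.Tendsto.inv₀ ?_ h)
          simpa using (hr0.add_const 1).sub_const (symbol a k)
        exact ht.liminf_eq.ge
    · fun_prop
  rw [hrec, top_le_iff] at h1
  have h2 : Filter.Tendsto
      (fun n => ∫⁻ k in box d, ENNReal.ofReal ((r n + 1 - symbol a k)⁻¹))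
      Filter.atTop (nhds ⊤) :=
    tendsto_of_le_liminf_of_limsup_le h1.ge le_top
  have h3 : ∀ n, ∫⁻ k in box d, ENNReal.ofReal ((r n + 1 - symbol a k)⁻¹) =
      ENNReal.ofReal (∫ k in box d, Real.cos (pairing k 0) / (r n + 1 - symbol a k)) := fun n => by
    rw [ofReal_integral_eq_lintegral_ofReal (integrableOn_green hpos hsum hnorm (hr n) 0)]
    · simp [pairing]
    · refine Filter.Eventually.of_forall fun k => ?_
      have := denom_pos hpos hsum hnorm (hr n) k
      simp [pairing, this.le]
  simp_rw [h3] at h2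
  exact (ENNReal.tendsto_ofReal_nhds_top.1 h2).const_mul_atTop (by positivity)

theorem apply_ne_zero_of_eigenvector {E : Type*} [NormedAddCommGroup E]
    [InnerProductSpace ℂ E] {H : E →L[ℂ] E} {l : E →L[ℂ] ℂ}
    (hl : ∀ χ, l χ = 0 → (inner ℂ (H χ) χ).re ≤ 0) {r : ℝ} (hr : 0 < r) {ψ : E} (hψ0 : ψ ≠ 0)
    (hψ : H ψ = (r : ℂ) • ψ) : l ψ ≠ 0 := by
  intro h
  have h1 := hl ψ h
  have h2 : (inner ℂ ψ ψ).re = ‖ψ‖ * ‖ψ‖ := inner_self_eq_norm_mul_norm (𝕜 := ℂ) ψ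
  rw [hψ, inner_smul_left, Complex.conj_ofReal, Complex.re_ofReal_mul, h2] at h1
  have := norm_pos_iff.2 hψ0
  have : 0 < r * (‖ψ‖ * ‖ψ‖) := by positivity
  linarith

theorem LinearMap.IsSymmetric.eigenvalue_unique_of_codim_one {E : Type*} [NormedAddCommGroup E]
    [InnerProductSpace ℂ E] {H : E →L[ℂ] E} (hH : (H : E →ₗ[ℂ] E).IsSymmetric) {l : E →L[ℂ] ℂ}
    (hl : ∀ χ, l χ = 0 → (inner ℂ (H χ) χ).re ≤ 0) {r s : ℝ} (hr : 0 < r) (hs : 0 < s) {ψ φ : E}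
    (hψ0 : ψ ≠ 0) (hφ0 : φ ≠ 0) (hψ : H ψ = (r : ℂ) • ψ) (hφ : H φ = (s : ℂ) • φ) : r = s := by
  by_contra hne
  have horth : inner ℂ ψ φ = 0 := by
    have h1 : inner ℂ (H ψ) φ = inner ℂ ψ (H φ) := hH ψ φ
    rw [hψ, hφ, inner_smul_left, inner_smul_right, Complex.conj_ofReal] at h1
    have h2 : ((r : ℂ) - s) * inner ℂ ψ φ = 0 := by linear_combination h1
    exact (mul_eq_zero.1 h2).resolve_left (sub_ne_zero.2 (by exact_mod_cast hne))
  have horth' : inner ℂ φ ψ = 0 := inner_eq_zero_symm.1 horth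
  have hlψ := apply_ne_zero_of_eigenvector hl hr hψ0 hψ
  have hlφ := apply_ne_zero_of_eigenvector hl hs hφ0 hφ
  have h := hl (l φ • ψ - l ψ • φ) (by simp [mul_comm])
  have h2 : inner ℂ (H (l φ • ψ - l ψ • φ)) (l φ • ψ - l ψ • φ) =
      ((r * (‖l φ‖ ^ 2 * ‖ψ‖ ^ 2) + s * (‖l ψ‖ ^ 2 * ‖φ‖ ^ 2) : ℝ) : ℂ) := by
    rw [map_sub, map_smul, map_smul, hψ, hφ]
    simp only [inner_sub_left, inner_sub_right, inner_smul_left, inner_smul_right, horth, horth',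
      Complex.conj_ofReal, inner_self_eq_norm_sq_to_K]
    push_cast
    rw [← Complex.conj_mul', ← Complex.conj_mul']
    simp
    ring
  rw [h2, Complex.ofReal_re] at h
  have h3 := norm_pos_iff.2 hψ0
  have h4 := norm_pos_iff.2 hφ0
  have h5 := norm_pos_iff.2 hlψ
  have h6 := norm_pos_iff.2 hlφ
  have : 0 < r * (‖l φ‖ ^ 2 * ‖ψ‖ ^ 2) + s * (‖l ψ‖ ^ 2 * ‖φ‖ ^ 2) := by positivity
  linarith

theorem exists_resolvent {E : Type*} [NormedAddCommGroup E] [InnerProductSpace ℂ E]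
    [CompleteSpace E] {L : E →L[ℂ] E} (hL : (-L).IsPositive) {r : ℝ} (hr : 0 < r) (y : E) :
    ∃ g, (r : ℂ) • g - L g = y := by
  obtain ⟨u, hu⟩ := ContinuousLinearMap.isUnit_algebraMap_sub hL hr
  refine ⟨(u⁻¹ : (E →L[ℂ] E)ˣ).val y, ?_⟩
  have h : u.val ((u⁻¹ : (E →L[ℂ] E)ˣ).val y) = y := by
    rw [← mul_apply_eq_comp, Units.mul_inv, one_apply_eq_self]
  rw [hu] at h
  simpa [Algebra.algebraMap_eq_smul_one] using h

theorem norm_apply_sub_apply_zero_sq_le {d : ℕ} {a : (Fin d → ℤ) → ℝ}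
    (hsymm : ∀ z, a (-z) = a z) (hpos : ∀ z, 0 ≤ a z) (ha0 : a 0 = 0) (hsum : Summable a)
    (hnorm : ∑' z, a z = 1)
    {L : lp (fun _ : Fin d → ℤ => ℂ) 2 →L[ℂ] lp (fun _ : Fin d → ℤ => ℂ) 2}
    (hL : ∀ f : lp (fun _ : Fin d → ℤ => ℂ) 2, ∀ x,
      L f x = ∑' z, (a z : ℂ) * (f (x + z) - f x))
    (hJint : IntegrableOn (fun k : Fin d → ℝ => Real.sqrt (∑ i, (k i) ^ 2) * (1 - symbol a k)⁻¹)
      (box d)) (ψ : lp (fun _ : Fin d → ℤ => ℂ) 2) (x : Fin d → ℤ) :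
    ‖ψ x - ψ 0‖ ^ 2 ≤
      2 * (∫ k in box d, Real.sqrt (∑ i, (k i) ^ 2) * (1 - symbol a k)⁻¹) *
        Real.sqrt (∑ i, ((x i : ℝ)) ^ 2) * (-(inner ℂ (L ψ) ψ).re) := by
  set J := ∫ k in box d, Real.sqrt (∑ i, (k i) ^ 2) * (1 - symbol a k)⁻¹
  have hLpos := isPositive_neg_generator hsymm hpos hsum hL
  have hmain : ∀ r : ℝ, 0 < r → ‖ψ x - ψ 0‖ ^ 2 ≤
      2 * J * Real.sqrt (∑ i, ((x i : ℝ)) ^ 2) * (r * ‖ψ‖ ^ 2 - (inner ℂ (L ψ) ψ).re) := by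
    intro r hr
    obtain ⟨g, hg⟩ := exists_resolvent hLpos hr (delta x)
    obtain ⟨g', hg'⟩ := exists_resolvent hLpos hr (delta (0 : Fin d → ℤ))
    let T := (r : ℂ) • ContinuousLinearMap.id ℂ (lp (fun _ : Fin d → ℤ => ℂ) 2) + -L
    have hTapp : ∀ f, T f = (r : ℂ) • f - L f := fun f => by
      rw [sub_eq_add_neg]
      rfl
    have hT : T.IsPositive :=
      (ContinuousLinearMap.isPositive_one.smul_of_nonneg (by exact_mod_cast hr.le)).add hLpos
    have hTg : T (g - g') = delta x - delta 0 := by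
      rw [map_sub, hTapp, hTapp, hg, hg']
    have hcs := hT.norm_inner_apply_sq_le (g - g') ψ
    rw [hTg, inner_sub_left, inner_delta_left, inner_delta_left, inner_sub_left,
      inner_delta_left, inner_delta_left] at hcs
    have hgx := resolvent_delta_apply hsymm hpos hsum hnorm hL hr hg
    have hgx' := resolvent_delta_apply hsymm hpos hsum hnorm hL hr hg'
    have hpsi : (inner ℂ (T ψ) ψ).re = r * ‖ψ‖ ^ 2 - (inner ℂ (L ψ) ψ).re := by
      have h2 : (inner ℂ ψ ψ).re = ‖ψ‖ * ‖ψ‖ := inner_self_eq_norm_mul_norm (𝕜 := ℂ) ψ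
      rw [hTapp, inner_sub_left, inner_smul_left, Complex.sub_re, Complex.conj_ofReal,
        Complex.re_ofReal_mul, h2, sq]
    rw [hpsi] at hcs
    refine hcs.trans (mul_le_mul_of_nonneg_right ?_ (hpsi ▸ hT.2 ψ))
    have h1 := green_zero_sub_green_le hpos ha0 hsum hnorm hJint hr x
    have h2 := green_zero_sub_green_le hpos ha0 hsum hnorm hJint hr (-x)
    have h3 : ∑ i, (((-x) i : ℤ) : ℝ) ^ 2 = ∑ i, ((x i : ℝ)) ^ 2 := by simp
    rw [h3] at h2
    have h4 : (((g - g' : lp (fun _ : Fin d → ℤ => ℂ) 2) x) -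
        ((g - g' : lp (fun _ : Fin d → ℤ => ℂ) 2) 0)).re =
        (green a r 0 - green a r x) + (green a r 0 - green a r (-x)) := by
      rw [lp.coeFn_sub, Pi.sub_apply, Pi.sub_apply, hgx, hgx, hgx', hgx']
      simp
      ring
    rw [h4]
    change _ ≤ 2 * J * _
    linarith
  have htend : Filter.Tendsto (fun r : ℝ => 2 * J * Real.sqrt (∑ i, ((x i : ℝ)) ^ 2) *
      (r * ‖ψ‖ ^ 2 - (inner ℂ (L ψ) ψ).re)) (nhdsWithin 0 (Set.Ioi 0))
      (nhds (2 * J * Real.sqrt (∑ i, ((x i : ℝ)) ^ 2) *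
        (0 * ‖ψ‖ ^ 2 - (inner ℂ (L ψ) ψ).re))) :=
    Filter.Tendsto.mono_left (Continuous.tendsto (by fun_prop) 0) nhdsWithin_le_nhds
  rw [zero_mul, zero_sub] at htend
  refine ge_of_tendsto htend ?_
  filter_upwards [self_mem_nhdsWithin] with r hr using hmain r hr

theorem re_inner_schrodinger_nonpos {d : ℕ} {a : (Fin d → ℤ) → ℝ}
    (hsymm : ∀ z, a (-z) = a z) (hpos : ∀ z, 0 ≤ a z) (ha0 : a 0 = 0) (hsum : Summable a)
    (hnorm : ∑' z, a z = 1)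
    {L : lp (fun _ : Fin d → ℤ => ℂ) 2 →L[ℂ] lp (fun _ : Fin d → ℤ => ℂ) 2}
    (hL : ∀ f : lp (fun _ : Fin d → ℤ => ℂ) 2, ∀ x,
      L f x = ∑' z, (a z : ℂ) * (f (x + z) - f x))
    (hJint : IntegrableOn (fun k : Fin d → ℝ => Real.sqrt (∑ i, (k i) ^ 2) * (1 - symbol a k)⁻¹)
      (box d)) {V : (Fin d → ℤ) → ℝ} (hV : Summable fun x => |V x|)
    (hxV : Summable fun x : Fin d → ℤ => Real.sqrt (∑ i, ((x i : ℝ)) ^ 2) * |V x|)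
    (hsmall : 2 * (∫ k in box d, Real.sqrt (∑ i, (k i) ^ 2) * (1 - symbol a k)⁻¹) *
      (∑' x : Fin d → ℤ, Real.sqrt (∑ i, ((x i : ℝ)) ^ 2) * |V x|) ≤ 1)
    {χ : lp (fun _ : Fin d → ℤ => ℂ) 2} (hχ : χ 0 = 0) :
    (inner ℂ ((L + potential V) χ) χ).re ≤ 0 := by
  set J := ∫ k in box d, Real.sqrt (∑ i, (k i) ^ 2) * (1 - symbol a k)⁻¹
  have hE : 0 ≤ -(inner ℂ (L χ) χ).re := by
    simpa [ContinuousLinearMap.reApplyInnerSelf] using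
      (isPositive_neg_generator hsymm hpos hsum hL).2 χ
  have h1 := Complex.hasSum_re (hasSum_inner_potential hV χ χ)
  have h2 : (inner ℂ (potential V χ) χ).re ≤
      (∑' x : Fin d → ℤ, Real.sqrt (∑ i, ((x i : ℝ)) ^ 2) * |V x|) *
        (2 * J * (-(inner ℂ (L χ) χ).re)) := by
    refine hasSum_le (fun x => ?_) h1 (hxV.hasSum.mul_right _)
    have h3 := norm_apply_sub_apply_zero_sq_le hsymm hpos ha0 hsum hnorm hL hJint χ x
    rw [hχ, sub_zero] at h3
    have h4 : (inner ℂ (χ x) (χ x)).re = ‖χ x‖ ^ 2 := by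
      rw [sq]
      exact inner_self_eq_norm_mul_norm (𝕜 := ℂ) (χ x)
    rw [Complex.re_ofReal_mul, h4]
    calc V x * ‖χ x‖ ^ 2 ≤ |V x| * ‖χ x‖ ^ 2 := by gcongr; exact le_abs_self _
      _ ≤ |V x| * (2 * J * Real.sqrt (∑ i, ((x i : ℝ)) ^ 2) * (-(inner ℂ (L χ) χ).re)) := by
        gcongr
      _ = _ := by ring
  have h5 := mul_le_mul_of_nonneg_right hsmall hE
  rw [add_apply, inner_add_left, Complex.add_re]
  linarith

theorem exists_re_inner_schrodinger_pos {d : ℕ} {a : (Fin d → ℤ) → ℝ}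
    (hsymm : ∀ z, a (-z) = a z) (hpos : ∀ z, 0 ≤ a z) (ha0 : a 0 = 0) (hsum : Summable a)
    (hnorm : ∑' z, a z = 1)
    {L : lp (fun _ : Fin d → ℤ => ℂ) 2 →L[ℂ] lp (fun _ : Fin d → ℤ => ℂ) 2}
    (hL : ∀ f : lp (fun _ : Fin d → ℤ => ℂ) 2, ∀ x,
      L f x = ∑' z, (a z : ℂ) * (f (x + z) - f x))
    (hrec : ∫⁻ k in box d, ENNReal.ofReal ((1 - symbol a k)⁻¹) = ⊤)
    (hJint : IntegrableOn (fun k : Fin d → ℝ => Real.sqrt (∑ i, (k i) ^ 2) * (1 - symbol a k)⁻¹)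
      (box d)) {V : (Fin d → ℤ) → ℝ} (hV : Summable fun x => |V x|) (hVpos : 0 < ∑' x, V x) :
    ∃ f, 0 < (inner ℂ ((L + potential V) f) f).re := by
  have hLpos := isPositive_neg_generator hsymm hpos hsum hL
  let r : ℕ → ℝ := fun n => 1 / ((n : ℝ) + 1)
  have hr : ∀ n, 0 < r n := fun n => by positivity
  have hG := tendsto_green_zero hpos hsum hnorm hrec hr tendsto_one_div_add_atTop_nhds_zero_nat
  have hGinv := hG.inv_tendsto_atTop
  have hratio : ∀ x, Filter.Tendsto (fun n => green a (r n) x / green a (r n) 0) Filter.atTop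
      (nhds 1) := fun x => by
    have h1 : Filter.Tendsto (fun n => (green a (r n) 0 - green a (r n) x) * (green a (r n) 0)⁻¹)
        Filter.atTop (nhds 0) := by
      have h0 := hGinv.const_mul
        ((∫ k in box d, Real.sqrt (∑ i, (k i) ^ 2) * (1 - symbol a k)⁻¹) *
          Real.sqrt (∑ i, ((x i : ℝ)) ^ 2))
      rw [mul_zero] at h0
      refine squeeze_zero' ?_ ?_ h0
      · filter_upwards [hG.eventually_gt_atTop 0] with n hn
        exact mul_nonneg (sub_nonneg.2 ((le_abs_self _).trans
          (abs_green_le hpos hsum hnorm (hr n) x))) (inv_nonneg.2 hn.le)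
      · filter_upwards [hG.eventually_gt_atTop 0] with n hn
        exact mul_le_mul_of_nonneg_right
          (green_zero_sub_green_le hpos ha0 hsum hnorm hJint (hr n) x) (inv_nonneg.2 hn.le)
    have h2 := h1.const_sub 1
    rw [sub_zero] at h2
    refine h2.congr' ?_
    filter_upwards [hG.eventually_gt_atTop 0] with n hn
    field_simp
    ring
  have hlim : Filter.Tendsto (fun n => ∑' x, V x * (green a (r n) x / green a (r n) 0) ^ 2)
      Filter.atTop (nhds (∑' x, V x)) := by
    refine tendsto_tsum_of_dominated_convergence hV (fun x => ?_)
      (Filter.Eventually.of_forall fun n x => ?_)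
    · simpa using ((hratio x).pow 2).const_mul (V x)
    · rw [norm_mul, Real.norm_eq_abs]
      refine mul_le_of_le_one_right (abs_nonneg _) ?_
      rw [norm_pow, norm_div]
      have h3 := abs_green_le hpos hsum hnorm (hr n) x
      exact pow_le_one₀ (by positivity) (div_le_one_of_le₀ (h3.trans (le_abs_self _))
        (norm_nonneg _))
  obtain ⟨n, hn1, hn2⟩ := ((hGinv.eventually_lt hlim hVpos).and
    (hG.eventually_gt_atTop 0)).exists
  obtain ⟨g, hg⟩ := exists_resolvent hLpos (hr n) (delta (0 : Fin d → ℤ))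
  have hgx : ∀ x, g x = green a (r n) x := fun x => by
    simpa using resolvent_delta_apply hsymm hpos hsum hnorm hL (hr n) hg x
  refine ⟨g, ?_⟩
  have hLg : -green a (r n) 0 ≤ (inner ℂ (L g) g).re := by
    have h1 : L g = ((r n : ℝ) : ℂ) • g - delta 0 := by rw [← hg, sub_sub_cancel]
    have h2 : (inner ℂ g g).re = ‖g‖ * ‖g‖ := inner_self_eq_norm_mul_norm (𝕜 := ℂ) g
    rw [h1, inner_sub_left, inner_smul_left, inner_delta_left, Complex.sub_re,
      Complex.conj_ofReal, Complex.re_ofReal_mul, h2, hgx, Complex.ofReal_re]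
    have : 0 ≤ r n * (‖g‖ * ‖g‖) := mul_nonneg (hr n).le (by positivity)
    linarith
  have hVg : (inner ℂ (potential V g) g).re =
      (∑' x, V x * (green a (r n) x / green a (r n) 0) ^ 2) * green a (r n) 0 ^ 2 := by
    rw [← (Complex.hasSum_re (hasSum_inner_potential hV g g)).tsum_eq, ← tsum_mul_right]
    refine tsum_congr fun x => ?_
    have h4 := inner_self_eq_norm_mul_norm (𝕜 := ℂ) (green a (r n) x : ℂ)
    rw [Complex.norm_real, Real.norm_eq_abs, abs_mul_abs_self] at h4
    rw [hgx, Complex.re_ofReal_mul, ← RCLike.re_eq_complex_re, h4]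
    field_simp
  rw [add_apply, inner_add_left, Complex.add_re, hVg]
  have h6 := mul_lt_mul_of_pos_right hn1 (pow_pos hn2 2)
  have h7 : (green a (r n) 0)⁻¹ * green a (r n) 0 ^ 2 = green a (r n) 0 := by
    field_simp
  simp only [Pi.inv_apply] at h6
  rw [h7] at h6
  linarith

/-- Theorem 3.3 of the paper: under the recurrence condition
`∫ (1-â(k))⁻¹ dk = ∞` and the finiteness condition
`J = ∫ |k| (1-â(k))⁻¹ dk < ∞`, if `Σ (1+|x|)|V(x)| < ∞` and `Σ V(x) > 0`, then for
every `0 < σ < σ₀ = (2 J Σ |x||V(x)|)⁻¹` the operator `H = 𝓛 + σV` on `ℓ²(ℤ^d)` has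
exactly one positive eigenvalue, and its eigenspace is one-dimensional. -/
theorem recurrent_unique_positive_eigenvalue (d : ℕ) (hd : 1 ≤ d)
    (a : (Fin d → ℤ) → ℝ)
    (hsymm : ∀ z, a (-z) = a z) (hpos : ∀ z, 0 ≤ a z) (ha0 : a 0 = 0)
    (hsum : Summable a) (hnorm : ∑' z, a z = 1)
    (L : lp (fun _ : Fin d → ℤ => ℂ) 2 →L[ℂ] lp (fun _ : Fin d → ℤ => ℂ) 2)
    (hL : ∀ f : lp (fun _ : Fin d → ℤ => ℂ) 2, ∀ x,
        L f x = ∑' z, (a z : ℂ) * (f (x + z) - f x))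
    (ahat : (Fin d → ℝ) → ℝ)
    (hahat : ∀ k, ahat k = ∑' z : Fin d → ℤ, a z * Real.cos (∑ i, k i * (z i : ℝ)))
    (hrec : ∫⁻ k in Set.Icc (fun _ => -Real.pi) (fun _ => Real.pi : Fin d → ℝ),
      ENNReal.ofReal ((1 - ahat k)⁻¹) = ⊤)
    (hJint : IntegrableOn
      (fun k : Fin d → ℝ => Real.sqrt (∑ i, (k i) ^ 2) * (1 - ahat k)⁻¹)
      (Set.Icc (fun _ => -Real.pi) (fun _ => Real.pi)) volume)
    (J : ℝ)
    (hJ : J = ∫ k in Set.Icc (fun _ => -Real.pi) (fun _ => Real.pi : Fin d → ℝ),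
      Real.sqrt (∑ i, (k i) ^ 2) * (1 - ahat k)⁻¹)
    (V : (Fin d → ℤ) → ℝ)
    (hVsum : Summable fun x : Fin d → ℤ =>
      (1 + Real.sqrt (∑ i, ((x i : ℝ)) ^ 2)) * |V x|)
    (hVpos : 0 < ∑' x, V x)
    (σ₀ : ℝ)
    (hσ₀ : σ₀ = (2 * J * ∑' x : Fin d → ℤ,
      Real.sqrt (∑ i, ((x i : ℝ)) ^ 2) * |V x|)⁻¹)
    (σ : ℝ) (hσ : 0 < σ) (hσlt : σ < σ₀) :
    (∃! lam : ℝ, 0 < lam ∧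
        ∃ ψ : lp (fun _ : Fin d → ℤ => ℂ) 2, ψ ≠ 0 ∧
          ∀ x, L ψ x + (σ : ℂ) * (V x : ℂ) * ψ x = (lam : ℂ) * ψ x) ∧
    (∀ lam : ℝ, 0 < lam →
      ∀ ψ φ : lp (fun _ : Fin d → ℤ => ℂ) 2, ψ ≠ 0 →
        (∀ x, L ψ x + (σ : ℂ) * (V x : ℂ) * ψ x = (lam : ℂ) * ψ x) →
        (∀ x, L φ x + (σ : ℂ) * (V x : ℂ) * φ x = (lam : ℂ) * φ x) →
        ∃ c : ℂ, φ = c • ψ) := by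
  obtain rfl : ahat = symbol a := funext hahat
  subst hJ
  have hVsum' : Summable fun x => |V x| :=
    Summable.of_nonneg_of_le (fun x => abs_nonneg _) (fun x => by
      nlinarith [abs_nonneg (V x), Real.sqrt_nonneg (∑ i, ((x i : ℝ)) ^ 2)]) hVsum
  have hxV : Summable fun x : Fin d → ℤ => Real.sqrt (∑ i, ((x i : ℝ)) ^ 2) * |V x| :=
    (hVsum.sub hVsum').congr fun x => by ring
  have hW : Summable fun x => |σ * V x| := by
    simpa [abs_mul] using hVsum'.mul_left |σ|
  have habs : ∀ x : Fin d → ℤ, Real.sqrt (∑ i, ((x i : ℝ)) ^ 2) * |σ * V x| =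
      σ * (Real.sqrt (∑ i, ((x i : ℝ)) ^ 2) * |V x|) := fun x => by
    rw [abs_mul, abs_of_pos hσ]
    ring
  have hxW : Summable fun x : Fin d → ℤ => Real.sqrt (∑ i, ((x i : ℝ)) ^ 2) * |σ * V x| := by
    simpa only [habs] using hxV.mul_left σ
  have hsmall : 2 * (∫ k in box d, Real.sqrt (∑ i, (k i) ^ 2) * (1 - symbol a k)⁻¹) *
      (∑' x : Fin d → ℤ, Real.sqrt (∑ i, ((x i : ℝ)) ^ 2) * |σ * V x|) ≤ 1 := by
    have hpos₀ : 0 < σ₀ := hσ.trans hσlt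
    rw [hσ₀, inv_pos] at hpos₀
    rw [hσ₀, ← one_div, lt_div_iff₀ hpos₀] at hσlt
    simp_rw [habs]
    rw [tsum_mul_left]
    change σ * (2 * (∫ k in box d, Real.sqrt (∑ i, (k i) ^ 2) * (1 - symbol a k)⁻¹) * _) < 1
      at hσlt
    linarith
  have hWpos : 0 < ∑' x, σ * V x := by
    rw [tsum_mul_left]
    exact mul_pos hσ hVpos
  have hLpos := isPositive_neg_generator hsymm hpos hsum hL
  have hLsa : IsSelfAdjoint L := by
    simpa using hLpos.isSelfAdjoint.neg
  have hHsa : IsSelfAdjoint (L + potential fun x => σ * V x) :=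
    hLsa.add (isSelfAdjoint_potential hW)
  have heig : ∀ (lam : ℝ) (ψ : lp (fun _ : Fin d → ℤ => ℂ) 2),
      (∀ x, L ψ x + (σ : ℂ) * (V x : ℂ) * ψ x = (lam : ℂ) * ψ x) ↔
        (L + potential fun x => σ * V x) ψ = (lam : ℂ) • ψ := fun lam ψ => by
    rw [lp.ext_iff, funext_iff]
    refine forall_congr' fun x => ?_
    have h : ((L + potential fun x => σ * V x) ψ) x = L ψ x + (σ : ℂ) * (V x : ℂ) * ψ x := by
      rw [add_apply, lp.coeFn_add, Pi.add_apply, potential_apply hW, Complex.ofReal_mul]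
    rw [h]
    rfl
  have hform : ∀ χ : lp (fun _ : Fin d → ℤ => ℂ) 2,
      lp.evalCLM ℂ (fun _ : Fin d → ℤ => ℂ) 2 0 χ = 0 →
      (inner ℂ ((L + potential fun x => σ * V x) χ) χ).re ≤ 0 := fun χ hχ =>
    re_inner_schrodinger_nonpos hsymm hpos ha0 hsum hnorm hL hJint hW hxW hsmall hχ
  simp_rw [heig]
  refine ⟨?_, fun lam hlam ψ φ hψ0 hψ hφ => ?_⟩
  · obtain ⟨f, hf⟩ :=
      exists_re_inner_schrodinger_pos hsymm hpos ha0 hsum hnorm hL hrec hJint hW hWpos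
    obtain ⟨lam, hlam, hspec⟩ := ContinuousLinearMap.exists_pos_mem_spectrum hHsa hf
    obtain ⟨ψ, hψ0, hψ⟩ := ContinuousLinearMap.exists_eigenvector_add_compact hLpos
      (isCompactOperator_potential hW) hlam hspec
    refine ⟨lam, ⟨hlam, ψ, hψ0, hψ⟩, ?_⟩
    rintro mu ⟨hmu, φ, hφ0, hφ⟩
    exact hHsa.isSymmetric.eigenvalue_unique_of_codim_one hform hmu hlam hφ0 hψ0 hφ hψ
  · have hψ00 : ψ 0 ≠ 0 := apply_ne_zero_of_eigenvector hform hlam hψ0 hψ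
    refine ⟨φ 0 / ψ 0, ?_⟩
    by_contra hne
    refine apply_ne_zero_of_eigenvector hform hlam (sub_ne_zero.2 hne) ?_ ?_
    · rw [map_sub, map_smul, hφ, hψ, smul_sub, smul_comm]
    · exact sub_eq_zero.2 (div_mul_cancel₀ (φ 0) hψ00).symm
end

section
/- Let V : ℤ → ℝ satisfy Σ_{x∈ℤ} (1 + |x|)|V(x)| < ∞, Σ_{x∈ℤ} V(x) ≥ 0, and V not identically zero. Then for every σ > 0 there exist λ > 0 and a nonzero ψ ∈ ℓ²(ℤ) such that ψ(x+1) + ψ(x−1) − 2ψ(x) + σV(x)ψ(x) = λψ(x) for every x ∈ ℤ; that is, the discrete operator Hψ(x) = ψ(x+1) + ψ(x−1) − 2ψ(x) + σV(x)ψ(x) on ℓ²(ℤ) has a positive eigenvalue for each σ > 0. -/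
open Filter Topology

/-- The summand of the quadratic form of the lattice operator with potential `W`. -/
def latticeEnergyDensity (W f : ℤ → ℝ) (x : ℤ) : ℝ :=
  W x * f x ^ 2 - (f (x + 1) - f x) ^ 2

/-- The quadratic form `⟨f, (Δ + W) f⟩` of the lattice operator with potential `W`. -/
noncomputable def latticeEnergy (W f : ℤ → ℝ) : ℝ :=
  ∑' x, latticeEnergyDensity W f x

/-- The discrete Schrödinger-type operator `Δ + W` acting on functions on `ℤ`. -/
def latticeOp (W f : ℤ → ℝ) (x : ℤ) : ℝ :=
  f (x + 1) + f (x - 1) - 2 * f x + W x * f x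

lemma summable_potential_mul_sq {W f : ℤ → ℝ} (hW : Summable W)
    (hf : Summable fun x => f x ^ 2) : Summable fun x => W x * f x ^ 2 := by
  refine (hW.abs.mul_right (∑' y, f y ^ 2)).of_norm_bounded fun x => ?_
  rw [Real.norm_eq_abs, abs_mul, abs_of_nonneg (sq_nonneg (f x))]
  gcongr
  exact hf.le_tsum x fun _ _ => sq_nonneg _

lemma summable_sq_forward_diff {f : ℤ → ℝ} (hf : Summable fun x => f x ^ 2) :
    Summable fun x => (f (x + 1) - f x) ^ 2 := by
  have hshift : Summable fun x => f (x + 1) ^ 2 :=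
    (Equiv.addRight (1 : ℤ)).summable_iff.mpr hf
  refine ((hshift.mul_left 2).add (hf.mul_left 2)).of_nonneg_of_le
    (fun _ => sq_nonneg _) fun x => ?_
  nlinarith [sq_nonneg (f (x + 1) + f x)]

lemma summable_latticeEnergyDensity {W f : ℤ → ℝ} (hW : Summable W)
    (hf : Summable fun x => f x ^ 2) : Summable (latticeEnergyDensity W f) :=
  (summable_potential_mul_sq hW hf).sub (summable_sq_forward_diff hf)

lemma latticeEnergy_eq_sub {W f : ℤ → ℝ} (hW : Summable W)
    (hf : Summable fun x => f x ^ 2) :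
    latticeEnergy W f = ∑' x, W x * f x ^ 2 - ∑' x, (f (x + 1) - f x) ^ 2 :=
  (summable_potential_mul_sq hW hf).tsum_sub (summable_sq_forward_diff hf)

lemma latticeEnergy_le {W f : ℤ → ℝ} (hW : Summable W)
    (hf : Summable fun x => f x ^ 2) : latticeEnergy W f ≤ ∑' x, W x * f x ^ 2 := by
  rw [latticeEnergy_eq_sub hW hf]
  exact sub_le_self _ (tsum_nonneg fun _ => sq_nonneg _)

lemma latticeEnergy_smul (W f : ℤ → ℝ) (c : ℝ) :
    latticeEnergy W (c • f) = c ^ 2 * latticeEnergy W f := by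
  rw [latticeEnergy, latticeEnergy, ← tsum_mul_left]
  congr 1 with x
  simp only [latticeEnergyDensity, Pi.smul_apply, smul_eq_mul]
  ring

lemma hasSum_sq_add_single {f : ℤ → ℝ} (hf : Summable fun x => f x ^ 2) (a : ℤ) (t : ℝ) :
    HasSum (fun x => (f + Pi.single a t : ℤ → ℝ) x ^ 2)
      (∑' x, f x ^ 2 + (2 * t * f a + t ^ 2)) := by
  convert! hf.hasSum.add (hasSum_ite_eq a (2 * t * f a + t ^ 2)) using 2 with x
  rw [Pi.add_apply, Pi.single_apply]
  split_ifs with h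
  · subst h; ring
  · ring

lemma latticeEnergy_add_single {W f : ℤ → ℝ} (hW : Summable W)
    (hf : Summable fun x => f x ^ 2) (a : ℤ) (t : ℝ) :
    latticeEnergy W (f + Pi.single a t) =
      latticeEnergy W f + 2 * t * latticeOp W f a + t ^ 2 * (W a - 2) := by
  have key := ((summable_latticeEnergyDensity hW hf).hasSum.add
    (hasSum_ite_eq a (W a * (2 * t * f a + t ^ 2) + 2 * t * (f (a + 1) - f a) - t ^ 2))).add
    (hasSum_ite_eq (a - 1) (-(2 * t * (f a - f (a - 1))) - t ^ 2))
  have hfun : latticeEnergyDensity W (f + Pi.single a t) = fun x =>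
      latticeEnergyDensity W f x +
        (if x = a then W a * (2 * t * f a + t ^ 2) + 2 * t * (f (a + 1) - f a) - t ^ 2 else 0) +
        (if x = a - 1 then -(2 * t * (f a - f (a - 1))) - t ^ 2 else 0) := by
    ext x
    simp only [latticeEnergyDensity, Pi.add_apply, Pi.single_apply]
    rcases eq_or_ne x a with rfl | h
    · have h : x ≠ x - 1 := by omega
      simp [h]
      ring
    · rcases eq_or_ne x (a - 1) with rfl | h'
      · simp
        ring
      · have : x + 1 ≠ a := fun e => h' (by omega)
        simp [h, h', this]
  rw [latticeEnergy, hfun, key.tsum_eq, latticeEnergy, latticeOp]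
  ring

/-- The tent function of height one supported on `(-n, n)`. -/
noncomputable def tent (n : ℕ) (x : ℤ) : ℝ := max 0 (1 - |(x : ℝ)| / n)

lemma tent_nonneg (n : ℕ) (x : ℤ) : 0 ≤ tent n x := le_max_left _ _

lemma tent_le_one (n : ℕ) (x : ℤ) : tent n x ≤ 1 :=
  max_le zero_le_one (sub_le_self _ (by positivity))

lemma tent_eq_zero {n : ℕ} (hn : 0 < n) {x : ℤ} (hx : (n : ℤ) ≤ |x|) : tent n x = 0 := by
  refine max_eq_left (sub_nonpos.mpr ?_)
  rw [one_le_div (by positivity)]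
  exact_mod_cast hx

lemma summable_tent_sq {n : ℕ} (hn : 0 < n) : Summable fun x => tent n x ^ 2 := by
  refine summable_of_ne_finset_zero (s := Finset.Ioo (-(n : ℤ)) n) fun x hx => ?_
  rw [tent_eq_zero hn, zero_pow two_ne_zero]
  rw [Finset.mem_Ioo, ← abs_lt] at hx
  exact not_lt.mp hx

lemma tendsto_tent (x : ℤ) : Tendsto (fun n => tent n x) atTop (𝓝 1) := by
  have h := tendsto_const_nhds (x := (0 : ℝ)).max
    ((tendsto_const_nhds (x := (1 : ℝ))).sub (tendsto_const_div_atTop_nhds_zero_nat |(x : ℝ)|))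
  simpa [tent] using h

lemma sq_tent_forward_diff_le (n : ℕ) (x : ℤ) :
    (tent n (x + 1) - tent n x) ^ 2 ≤ (1 / (n : ℝ)) ^ 2 := by
  have h : |tent n (x + 1) - tent n x| ≤ 1 / (n : ℝ) := by
    have hx : |(|((x + 1 : ℤ) : ℝ)| - |(x : ℝ)|)| ≤ 1 := by
      simpa using abs_abs_sub_abs_le ((x + 1 : ℤ) : ℝ) (x : ℝ)
    rw [tent, tent, max_comm 0, max_comm 0]
    refine (abs_max_sub_max_le_abs _ _ _).trans ?_
    rw [sub_sub_sub_cancel_left, ← sub_div, abs_div, Nat.abs_cast, abs_sub_comm]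
    gcongr
  rw [← sq_abs]
  gcongr

lemma tsum_sq_tent_forward_diff_le {n : ℕ} (hn : 0 < n) :
    ∑' x, (tent n (x + 1) - tent n x) ^ 2 ≤ 2 / (n : ℝ) := by
  rw [tsum_eq_sum (s := Finset.Ico (-(n : ℤ)) n)]
  · refine (Finset.sum_le_card_nsmul _ _ _ fun x _ => sq_tent_forward_diff_le n x).trans_eq ?_
    have hcard : ((n : ℤ) - -n).toNat = 2 * n := by omega
    rw [Int.card_Ico, hcard, nsmul_eq_mul]
    push_cast
    field_simp
  · intro x hx
    rw [Finset.mem_Ico] at hx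
    rw [tent_eq_zero hn (x := x), tent_eq_zero hn (x := x + 1)]
    · simp
    · rw [le_abs]; omega
    · rw [le_abs]; omega

lemma tendsto_tsum_sq_tent_forward_diff :
    Tendsto (fun n => ∑' x, (tent n (x + 1) - tent n x) ^ 2) atTop (𝓝 0) :=
  squeeze_zero' (.of_forall fun _ => tsum_nonneg fun _ => sq_nonneg _)
    ((eventually_gt_atTop 0).mono fun _ hn => tsum_sq_tent_forward_diff_le hn)
    (tendsto_const_div_atTop_nhds_zero_nat 2)

lemma tendsto_latticeEnergy_tent {W : ℤ → ℝ} (hW : Summable W) :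
    Tendsto (fun n => latticeEnergy W (tent n)) atTop (𝓝 (∑' x, W x)) := by
  have hpot : Tendsto (fun n => ∑' x, W x * tent n x ^ 2) atTop (𝓝 (∑' x, W x)) := by
    refine tendsto_tsum_of_dominated_convergence hW.abs (fun x => ?_) (.of_forall fun n x => ?_)
    · simpa using ((tendsto_tent x).pow 2).const_mul (W x)
    · rw [Real.norm_eq_abs, abs_mul, abs_of_nonneg (sq_nonneg (tent n x))]
      exact mul_le_of_le_one_right (abs_nonneg _)
        (pow_le_one₀ (tent_nonneg n x) (tent_le_one n x))
  have h := hpot.sub tendsto_tsum_sq_tent_forward_diff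
  rw [sub_zero] at h
  refine h.congr' ((eventually_gt_atTop 0).mono fun n hn => ?_)
  exact (latticeEnergy_eq_sub hW (summable_tent_sq hn)).symm

/-- A nonzero summable potential of nonnegative mean has a state of positive energy. -/
lemma exists_latticeEnergy_pos {W : ℤ → ℝ} (hW : Summable W) (hmean : 0 ≤ ∑' x, W x)
    (hne : ∃ x, W x ≠ 0) :
    ∃ f : ℤ → ℝ, (Summable fun x => f x ^ 2) ∧ 0 < latticeEnergy W f := by
  obtain ⟨a, ha⟩ : ∃ a, 0 < W a := by
    by_contra! hnonpos
    obtain ⟨b, hb⟩ := hne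
    have := hW.tsum_lt_tsum (i := b) (g := fun _ => (0 : ℝ)) hnonpos
      (lt_of_le_of_ne (hnonpos b) hb) summable_zero
    rw [tsum_zero] at this
    exact this.not_ge hmean
  have hop : Tendsto (fun n => latticeOp W (tent n) a) atTop (𝓝 (W a)) := by
    have h := (((tendsto_tent (a + 1)).add (tendsto_tent (a - 1))).sub
      ((tendsto_tent a).const_mul 2)).add ((tendsto_tent a).const_mul (W a))
    convert! h using 2
    ring
  have hlim := ((tendsto_latticeEnergy_tent hW).add (hop.const_mul (2 * (W a / 2)))).add_const
    ((W a / 2) ^ 2 * (W a - 2))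
  have hpos : 0 < ∑' x, W x + 2 * (W a / 2) * W a + (W a / 2) ^ 2 * (W a - 2) := by
    nlinarith [pow_pos ha 2, pow_pos ha 3]
  obtain ⟨n, hn, hn0⟩ := ((hlim.eventually_const_lt hpos).and (eventually_gt_atTop 0)).exists
  refine ⟨tent n + Pi.single a (W a / 2),
    (hasSum_sq_add_single (summable_tent_sq hn0) a _).summable, ?_⟩
  rwa [latticeEnergy_add_single hW (summable_tent_sq hn0)]

/-- If the quadratic form is bounded above by `lam`, then the residual of the eigenvalue equation
at each site is controlled by the energy defect. -/
lemma sq_residual_le {W : ℤ → ℝ} (hW : Summable W) {lam : ℝ}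
    (hlam : ∀ f : ℤ → ℝ, (Summable fun x => f x ^ 2) →
      latticeEnergy W f ≤ lam * ∑' x, f x ^ 2)
    {f : ℤ → ℝ} (hf : Summable fun x => f x ^ 2) (a : ℤ) :
    (lam * f a - latticeOp W f a) ^ 2 ≤
      (lam + 2 - W a) * (lam * ∑' x, f x ^ 2 - latticeEnergy W f) := by
  have h := discrim_le_zero (a := lam + 2 - W a) (b := 2 * (lam * f a - latticeOp W f a))
    (c := lam * ∑' x, f x ^ 2 - latticeEnergy W f) fun t => by
      have hsum := hasSum_sq_add_single hf a t
      have := hlam _ hsum.summable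
      rw [hsum.tsum_eq, latticeEnergy_add_single hW hf] at this
      linarith
  rw [discrim] at h
  linarith

lemma latticeEnergy_le_tsum_abs {W f : ℤ → ℝ} (hW : Summable W)
    (hf : Summable fun x => f x ^ 2) (hle : ∀ x, f x ^ 2 ≤ 1) :
    latticeEnergy W f ≤ ∑' x, |W x| := by
  refine (latticeEnergy_le hW hf).trans
    ((summable_potential_mul_sq hW hf).tsum_le_tsum (fun x => ?_) hW.abs)
  calc W x * f x ^ 2 ≤ |W x| * f x ^ 2 := by gcongr; exact le_abs_self _
    _ ≤ |W x| := mul_le_of_le_one_right (abs_nonneg _) (hle x)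

lemma sq_apply_le_one {f : ℤ → ℝ} (hf : HasSum (fun x => f x ^ 2) 1) (x : ℤ) : f x ^ 2 ≤ 1 :=
  le_hasSum hf x fun _ _ => sq_nonneg _

/-- A summable potential admitting a state of positive energy has a square-summable eigenfunction
with positive eigenvalue. -/
lemma exists_eigenfunction_of_latticeEnergy_pos {W : ℤ → ℝ} (hW : Summable W)
    (hpos : ∃ f : ℤ → ℝ, (Summable fun x => f x ^ 2) ∧ 0 < latticeEnergy W f) :
    ∃ lam : ℝ, 0 < lam ∧ ∃ φ : ℤ → ℝ, (Summable fun x => φ x ^ 2) ∧ φ ≠ 0 ∧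
      ∀ x, latticeOp W φ x = lam * φ x := by
  set S : Set ℝ := latticeEnergy W '' {f | HasSum (fun x => f x ^ 2) 1}
  have hbdd : BddAbove S := by
    refine ⟨∑' x, |W x|, ?_⟩
    rintro _ ⟨f, hf, rfl⟩
    exact latticeEnergy_le_tsum_abs hW hf.summable (sq_apply_le_one hf)
  have hnormalize {f : ℤ → ℝ} (hf : Summable fun x => f x ^ 2) (hN : 0 < ∑' x, f x ^ 2) :
      (∑' x, f x ^ 2)⁻¹ * latticeEnergy W f ∈ S := by
    refine ⟨(√(∑' x, f x ^ 2))⁻¹ • f, ?_, ?_⟩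
    · have h := hf.hasSum.mul_left (∑' x, f x ^ 2)⁻¹
      rw [inv_mul_cancel₀ hN.ne'] at h
      simpa [mul_pow, Real.sq_sqrt hN.le] using h
    · rw [latticeEnergy_smul, inv_pow, Real.sq_sqrt hN.le]
  have hzero {f : ℤ → ℝ} (hf : Summable fun x => f x ^ 2) (hN : ∑' x, f x ^ 2 = 0) :
      latticeEnergy W f = 0 := by
    have h := (hasSum_zero_iff_of_nonneg fun x => sq_nonneg (f x)).mp (hN ▸ hf.hasSum)
    have hf0 : f = 0 := funext fun x => pow_eq_zero_iff two_ne_zero |>.mp (congrFun h x)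
    simp [hf0, latticeEnergy, latticeEnergyDensity]
  set lam := sSup S
  have hlam (f : ℤ → ℝ) (hf : Summable fun x => f x ^ 2) :
      latticeEnergy W f ≤ lam * ∑' x, f x ^ 2 := by
    rcases (tsum_nonneg fun x => sq_nonneg (f x)).eq_or_lt with h0 | hN
    · rw [hzero hf h0.symm, ← h0, mul_zero]
    · have := le_csSup hbdd (hnormalize hf hN)
      rwa [inv_mul_le_iff₀' hN] at this
  obtain ⟨f₀, hf₀, hE₀⟩ := hpos
  have hN₀ : 0 < ∑' x, f₀ x ^ 2 :=
    (tsum_nonneg fun x => sq_nonneg (f₀ x)).lt_of_ne fun h => hE₀.ne' (hzero hf₀ h.symm)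
  have hlam_pos : 0 < lam := pos_of_mul_pos_left (hE₀.trans_le (hlam f₀ hf₀)) hN₀.le
  obtain ⟨u, -, hu, huS⟩ := exists_seq_tendsto_sSup ⟨_, hnormalize hf₀ hN₀⟩ hbdd
  choose g hg hgu using huS
  have hmem (n : ℕ) : g n ∈ Set.univ.pi fun _ : ℤ => Set.Icc (-1 : ℝ) 1 := fun x _ =>
    abs_le.mp ((sq_le_one_iff_abs_le_one _).mp (sq_apply_le_one (hg n) x))
  obtain ⟨φ, -, k, hk, hgφ⟩ :=
    (isCompact_univ_pi fun _ : ℤ => isCompact_Icc (a := (-1 : ℝ)) (b := 1)).tendsto_subseq hmem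
  have hφ : ∀ x, Tendsto (fun n => g (k n) x) atTop (𝓝 (φ x)) := tendsto_pi_nhds.mp hgφ
  have hE : Tendsto (fun n => latticeEnergy W (g (k n))) atTop (𝓝 lam) := by
    simpa only [hgu, Function.comp_def] using hu.comp hk.tendsto_atTop
  refine ⟨lam, hlam_pos, φ, ?_, ?_, fun a => ?_⟩
  · refine summable_of_sum_le (c := 1) (fun x => sq_nonneg (φ x)) fun s => ?_
    refine le_of_tendsto' (tendsto_finsetSum s fun x _ => (hφ x).pow 2) fun n => ?_
    exact sum_le_hasSum s (fun _ _ => sq_nonneg _) (hg (k n))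
  · rintro rfl
    have hpot : Tendsto (fun n => ∑' x, W x * g (k n) x ^ 2) atTop (𝓝 (∑' _ : ℤ, (0 : ℝ))) := by
      refine tendsto_tsum_of_dominated_convergence hW.abs (fun x => ?_)
        (.of_forall fun n x => ?_)
      · simpa using ((hφ x).pow 2).const_mul (W x)
      · rw [Real.norm_eq_abs, abs_mul, abs_of_nonneg (sq_nonneg (g (k n) x))]
        exact mul_le_of_le_one_right (abs_nonneg _) (sq_apply_le_one (hg (k n)) x)
    rw [tsum_zero] at hpot
    exact hlam_pos.not_ge
      (le_of_tendsto_of_tendsto' hE hpot fun n => latticeEnergy_le hW (hg (k n)).summable)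
  · have hres : Tendsto (fun n => (lam * g (k n) a - latticeOp W (g (k n)) a) ^ 2) atTop
        (𝓝 ((lam * φ a - latticeOp W φ a) ^ 2)) :=
      (((hφ a).const_mul lam).sub ((((hφ (a + 1)).add (hφ (a - 1))).sub
        ((hφ a).const_mul 2)).add ((hφ a).const_mul (W a)))).pow 2
    have hbound : Tendsto (fun n => (lam + 2 - W a) * (lam - latticeEnergy W (g (k n)))) atTop
        (𝓝 0) := by
      simpa using (hE.const_sub lam).const_mul (lam + 2 - W a)
    have hle := le_of_tendsto_of_tendsto' hres hbound fun n => by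
      simpa [(hg (k n)).tsum_eq] using sq_residual_le hW hlam (hg (k n)).summable a
    have := pow_eq_zero_iff two_ne_zero |>.mp (hle.antisymm (sq_nonneg _))
    linarith

/-- Theorem 3.4 (lattice case): if `V : ℤ → ℝ` satisfies `Σ (1+|x|)|V(x)| < ∞`,
`Σ V(x) ≥ 0` and `V` is not identically zero, then for every `σ > 0` the discrete
operator `Hψ(x) = ψ(x+1) + ψ(x-1) - 2ψ(x) + σV(x)ψ(x)` on `ℓ²(ℤ)` has a positive
eigenvalue. -/
theorem lattice_zero_mean_positive_eigenvalue (V : ℤ → ℝ)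
    (hVsum : Summable fun x : ℤ => (1 + |(x : ℝ)|) * |V x|)
    (hVmean : 0 ≤ ∑' x : ℤ, V x)
    (hVne : ∃ x, V x ≠ 0)
    (σ : ℝ) (hσ : 0 < σ) :
    ∃ lam : ℝ, 0 < lam ∧
      ∃ ψ : lp (fun _ : ℤ => ℝ) 2, ψ ≠ 0 ∧
        ∀ x : ℤ, ψ (x + 1) + ψ (x - 1) - 2 * ψ x + σ * V x * ψ x = lam * ψ x := by
  have hV : Summable V := by
    refine hVsum.of_norm_bounded fun x => ?_
    exact le_mul_of_one_le_left (abs_nonneg _) (le_add_of_nonneg_right (abs_nonneg _))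
  have hmean : 0 ≤ ∑' x, σ * V x := by
    rw [tsum_mul_left]
    exact mul_nonneg hσ.le hVmean
  have hne : ∃ x, σ * V x ≠ 0 := hVne.imp fun _ h => mul_ne_zero hσ.ne' h
  obtain ⟨lam, hlam, φ, hφ, hφ0, heq⟩ := exists_eigenfunction_of_latticeEnergy_pos
    (hV.mul_left σ) (exists_latticeEnergy_pos (hV.mul_left σ) hmean hne)
  have hmem : Memℓp φ 2 := by
    rw [memℓp_gen_iff (by norm_num)]
    simpa using hφ
  exact ⟨lam, hlam, ⟨φ, hmem⟩, fun h => hφ0 (congrArg Subtype.val h), heq⟩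
end

section
/- Let V : [0,∞) → ℝ be measurable with ∫_0^∞ (1 + ξ)|V(ξ)| dξ < ∞. Then there exist σ₀ > 0 and C > 0 such that for every σ with |σ| ≤ σ₀ there is a function ψ₁ on [0,∞), continuously differentiable with ψ₁′ locally absolutely continuous, solving ψ₁″(x) + σV(x)ψ₁(x) = 0 for almost every x ≥ 0, with ψ₁(0) = 1, sup_{x≥0} |ψ₁(x) − 1| ≤ C|σ|, sup_{x≥0} |ψ₁′(x)| ≤ C|σ|, and whose derivative at 0 satisfies |ψ₁′(0) − σb − σ²c²| ≤ C|σ|³, where b = ∫_0^∞ V(ξ) dξ and c² = ∫_0^∞ ( ∫_η^∞ V(ξ) dξ )² dη. -/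
open MeasureTheory

/-- The tail integral `∫_η^∞ U`. -/
noncomputable def tailIntegral (U : ℝ → ℝ) (η : ℝ) : ℝ := ∫ ξ in Set.Ioi η, U ξ

lemma tailIntegral_eq_sub {U : ℝ → ℝ} (hU : Integrable U) (x : ℝ) :
    tailIntegral U x = tailIntegral U 0 - ∫ t in (0:ℝ)..x, U t := by
  have h := intervalIntegral.integral_interval_add_Ioi (a := 0) (b := x)
    hU.integrableOn hU.integrableOn
  unfold tailIntegral
  linarith

lemma continuous_tailIntegral {U : ℝ → ℝ} (hU : Integrable U) :
    Continuous (tailIntegral U) := by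
  rw [funext (tailIntegral_eq_sub hU)]
  exact continuous_const.sub
    (intervalIntegral.continuous_primitive (fun _ _ => hU.intervalIntegrable) 0)

lemma tailIntegral_abs_nonneg (U : ℝ → ℝ) (η : ℝ) : 0 ≤ tailIntegral (fun t => |U t|) η :=
  integral_nonneg fun _ => abs_nonneg _

lemma tailIntegral_abs_antitone {U : ℝ → ℝ} (hU : Integrable U) :
    Antitone (tailIntegral fun t => |U t|) := fun _ _ h =>
  setIntegral_mono_set hU.abs.integrableOn (.of_forall fun _ => abs_nonneg _)
    (Set.Ioi_subset_Ioi h).eventuallyLE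

/-- If `|φ| ≤ c` on `[0, ∞)` then `|∫_η^∞ U φ| ≤ c ∫_η^∞ |U|` for `η ≥ 0`. -/
lemma abs_tailIntegral_mul_le {U φ : ℝ → ℝ} {c : ℝ} (hU : Integrable U)
    (hφ : ∀ t, 0 ≤ t → |φ t| ≤ c) {η : ℝ} (hη : 0 ≤ η) :
    |tailIntegral (fun t => U t * φ t) η| ≤ c * tailIntegral (fun t => |U t|) η := by
  have : c * tailIntegral (fun t => |U t|) η = ∫ t in Set.Ioi η, c * |U t| :=
    (integral_const_mul _ _).symm
  rw [this, ← Real.norm_eq_abs]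
  refine norm_integral_le_of_norm_le (hU.abs.integrableOn.const_mul c) ?_
  filter_upwards [ae_restrict_mem measurableSet_Ioi] with t ht
  rw [norm_mul, Real.norm_eq_abs, Real.norm_eq_abs, mul_comm]
  exact mul_le_mul_of_nonneg_right (hφ t (hη.trans (le_of_lt ht))) (abs_nonneg _)

lemma Continuous.integrable_mul_of_bounded {U φ : ℝ → ℝ} {c : ℝ} (hφ : Continuous φ)
    (hU : Integrable U) (hc : ∀ t, |φ t| ≤ c) : Integrable fun t => U t * φ t :=
  hU.mul_bdd (c := c) hφ.aestronglyMeasurable (.of_forall hc)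

/-- A finite first moment makes `U x` integrable over the wedge `0 < η < x`. -/
lemma integrable_wedge {U : ℝ → ℝ} (hU : Integrable U)
    (hU1 : IntegrableOn (fun x => x * |U x|) (Set.Ioi 0)) :
    Integrable (Set.indicator {p : ℝ × ℝ | p.2 < p.1} fun p => U p.1)
      ((volume.restrict (Set.Ioi 0)).prod (volume.restrict (Set.Ioi 0))) := by
  have hS : MeasurableSet {p : ℝ × ℝ | p.2 < p.1} := measurableSet_lt measurable_snd measurable_fst
  have key (x : ℝ) : (fun η => (Set.indicator {p : ℝ × ℝ | p.2 < p.1} (fun p => U p.1)) (x, η))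
      = Set.indicator (Set.Iio x) fun _ => U x := rfl
  have hfin (x : ℝ) : volume (Set.Iio x ∩ Set.Ioi 0) ≠ ⊤ := by
    rw [Set.inter_comm, Set.Ioi_inter_Iio]; simp
  refine (integrable_prod_iff ?_).2 ⟨?_, ?_⟩
  · exact (hU.integrableOn.aestronglyMeasurable.comp_fst).indicator hS
  · refine .of_forall fun x => ?_
    rw [key, integrable_indicator_iff measurableSet_Iio, IntegrableOn,
      Measure.restrict_restrict measurableSet_Iio]
    exact integrableOn_const (hfin x)
  · refine hU1.congr ?_
    filter_upwards [ae_restrict_mem measurableSet_Ioi] with x hx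
    have : (fun η => ‖(Set.indicator {p : ℝ × ℝ | p.2 < p.1} (fun p => U p.1)) (x, η)‖)
        = Set.indicator (Set.Iio x) fun _ => |U x| := by
      funext η
      rw [congrFun (key x) η, norm_indicator_eq_indicator_norm]; rfl
    rw [this, integral_indicator measurableSet_Iio, Measure.restrict_restrict measurableSet_Iio,
      Set.inter_comm, Set.Ioi_inter_Iio]
    simp [le_of_lt (Set.mem_Ioi.1 hx)]

lemma integral_wedge_fst (U : ℝ → ℝ) {η : ℝ} (hη : 0 ≤ η) :
    ∫ x in Set.Ioi (0:ℝ), (Set.indicator {p : ℝ × ℝ | p.2 < p.1} fun p => U p.1) (x, η)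
      = tailIntegral U η := by
  have : (fun x => (Set.indicator {p : ℝ × ℝ | p.2 < p.1} fun p => U p.1) (x, η))
      = Set.indicator (Set.Ioi η) U := rfl
  rw [this, integral_indicator measurableSet_Ioi, Measure.restrict_restrict measurableSet_Ioi,
    Set.inter_eq_left.2 (Set.Ioi_subset_Ioi hη)]
  rfl

lemma integrableOn_tailIntegral {U : ℝ → ℝ} (hU : Integrable U)
    (hU1 : IntegrableOn (fun x => x * |U x|) (Set.Ioi 0)) :
    IntegrableOn (tailIntegral U) (Set.Ioi 0) := by
  refine (integrable_wedge hU hU1).integral_prod_right.congr ?_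
  filter_upwards [ae_restrict_mem measurableSet_Ioi] with η hη
  exact integral_wedge_fst U (le_of_lt hη)

/-- Fubini: `∫_0^∞ U(x) ∫_0^x G(η) dη dx = ∫_0^∞ G(η) ∫_η^∞ U(x) dx dη`. -/
lemma integral_mul_primitive {U G : ℝ → ℝ} {c : ℝ} (hU : Integrable U)
    (hU1 : IntegrableOn (fun x => x * |U x|) (Set.Ioi 0)) (hG : Continuous G)
    (hc : ∀ t, 0 ≤ t → |G t| ≤ c) :
    ∫ x in Set.Ioi (0:ℝ), U x * ∫ η in (0:ℝ)..x, G η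
      = ∫ η in Set.Ioi (0:ℝ), tailIntegral U η * G η := by
  set W : ℝ × ℝ → ℝ := Set.indicator {p : ℝ × ℝ | p.2 < p.1} fun p => U p.1 with hW
  have hint : Integrable (Function.uncurry fun x η => W (x, η) * G η)
      ((volume.restrict (Set.Ioi 0)).prod (volume.restrict (Set.Ioi 0))) := by
    refine (integrable_wedge hU hU1).mul_bdd (c := c)
      (hG.comp continuous_snd).aestronglyMeasurable ?_
    rw [Measure.prod_restrict]
    filter_upwards [ae_restrict_mem (measurableSet_Ioi.prod measurableSet_Ioi)] with p hp
    exact hc _ (le_of_lt hp.2)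
  have hswap := integral_integral_swap hint
  calc _ = ∫ x in Set.Ioi (0:ℝ), ∫ η in Set.Ioi (0:ℝ), W (x, η) * G η := by
        refine setIntegral_congr_fun measurableSet_Ioi fun x hx => ?_
        have : (fun η => W (x, η) * G η) = Set.indicator (Set.Iio x) fun η => U x * G η := by
          funext η
          by_cases h : η < x <;> simp [hW, h]
        simp only [this]
        rw [integral_indicator measurableSet_Iio, Measure.restrict_restrict measurableSet_Iio,
          Set.inter_comm, Set.Ioi_inter_Iio, integral_const_mul,
          intervalIntegral.integral_of_le (le_of_lt hx), integral_Ioc_eq_integral_Ioo]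
    _ = _ := hswap
    _ = _ := by
        refine setIntegral_congr_fun measurableSet_Ioi fun η hη => ?_
        simp only [integral_mul_const]
        rw [hW, integral_wedge_fst U (le_of_lt hη)]

lemma abs_integral_tailIntegral_mul_le {U φ : ℝ → ℝ} {c x : ℝ} (hU : Integrable U)
    (hU1 : IntegrableOn (fun x => x * |U x|) (Set.Ioi 0)) (hφ : ∀ t, 0 ≤ t → |φ t| ≤ c)
    (hx : 0 ≤ x) :
    |∫ η in (0:ℝ)..x, tailIntegral (fun t => U t * φ t) η|
      ≤ c * ∫ η in Set.Ioi (0:ℝ), tailIntegral (fun t => |U t|) η := by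
  have hc : 0 ≤ c := (abs_nonneg _).trans (hφ 0 le_rfl)
  have hw : IntegrableOn (tailIntegral fun t => |U t|) (Set.Ioi 0) :=
    integrableOn_tailIntegral hU.abs (by simpa using hU1)
  have hcont := continuous_tailIntegral hU.abs
  rw [← Real.norm_eq_abs]
  calc _ ≤ ∫ η in (0:ℝ)..x, c * tailIntegral (fun t => |U t|) η := by
        refine intervalIntegral.norm_integral_le_of_norm_le hx (.of_forall fun η hη => ?_)
          ((continuous_const.mul hcont).intervalIntegrable _ _)
        exact abs_tailIntegral_mul_le hU hφ hη.1.le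
    _ = c * ∫ η in Set.Ioc 0 x, tailIntegral (fun t => |U t|) η := by
        rw [intervalIntegral.integral_const_mul, intervalIntegral.integral_of_le hx]
    _ ≤ _ := mul_le_mul_of_nonneg_left (setIntegral_mono_set hw
        (.of_forall fun η => tailIntegral_abs_nonneg U η)
        Set.Ioc_subset_Ioi_self.eventuallyLE) hc

/-- The bounded solution of `f(x) = 1 + σ ∫_0^x ∫_η^∞ U f` for small `σ`, with `x` replaced by its
positive part. -/
lemma exists_bounded_fixedPoint {U : ℝ → ℝ} (hU : Integrable U)
    (hU1 : IntegrableOn (fun x => x * |U x|) (Set.Ioi 0)) {σ : ℝ}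
    (hσ : |σ| * (∫ η in Set.Ioi (0:ℝ), tailIntegral (fun t => |U t|) η) ≤ 1 / 2) :
    ∃ f : ℝ → ℝ, Continuous f ∧ (∀ x, |f x| ≤ 2) ∧
      ∀ x, f x = 1 + σ * ∫ η in (0:ℝ)..max x 0, tailIntegral (fun t => U t * f t) η := by
  set M := ∫ η in Set.Ioi (0:ℝ), tailIntegral (fun t => |U t|) η with hM
  have hint (f : BoundedContinuousFunction ℝ ℝ) : Integrable fun t => U t * f t :=
    f.continuous.integrable_mul_of_bounded hU f.norm_coe_le_norm
  have hcont (f : BoundedContinuousFunction ℝ ℝ) : Continuous fun x =>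
      1 + σ * ∫ η in (0:ℝ)..max x 0, tailIntegral (fun t => U t * f t) η := by
    have := (intervalIntegral.continuous_primitive (μ := volume)
      (fun a b => (continuous_tailIntegral (hint f)).intervalIntegrable a b) 0).comp
      (continuous_id.max (continuous_const (y := (0:ℝ))))
    exact continuous_const.add (continuous_const.mul this)
  have hbd (φ : ℝ → ℝ) (c : ℝ) (hφ : ∀ t, |φ t| ≤ c) (x : ℝ) :
      |σ * ∫ η in (0:ℝ)..max x 0, tailIntegral (fun t => U t * φ t) η| ≤ 1 / 2 * c := by
    have hc : 0 ≤ c := (abs_nonneg _).trans (hφ 0)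
    rw [abs_mul]
    calc _ ≤ |σ| * (c * M) := mul_le_mul_of_nonneg_left
          (abs_integral_tailIntegral_mul_le hU hU1 (fun t _ => hφ t) (le_max_right _ _))
          (abs_nonneg _)
      _ = |σ| * M * c := by ring
      _ ≤ _ := mul_le_mul_of_nonneg_right hσ hc
  let T : BoundedContinuousFunction ℝ ℝ → BoundedContinuousFunction ℝ ℝ := fun f =>
    .ofNormedAddCommGroup _ (hcont f) (1 + 1 / 2 * ‖f‖) fun x =>
      (norm_add_le _ _).trans (by
        rw [norm_one]
        exact add_le_add_right (hbd f _ f.norm_coe_le_norm x) 1)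
  have hT (f : BoundedContinuousFunction ℝ ℝ) (x : ℝ) : T f x =
      1 + σ * ∫ η in (0:ℝ)..max x 0, tailIntegral (fun t => U t * f t) η := rfl
  have hcontr : ContractingWith (1 / 2) T := by
    refine ⟨by norm_num, LipschitzWith.of_dist_le_mul fun f g => ?_⟩
    refine (BoundedContinuousFunction.dist_le (by positivity)).2 fun x => ?_
    have hsub : T f x - T g x =
        σ * ∫ η in (0:ℝ)..max x 0, tailIntegral (fun t => U t * (f t - g t)) η := by
      have h (η : ℝ) : tailIntegral (fun t => U t * (f t - g t)) η =
          tailIntegral (fun t => U t * f t) η - tailIntegral (fun t => U t * g t) η := by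
        simp only [tailIntegral, mul_sub]
        exact integral_sub (hint f).integrableOn (hint g).integrableOn
      simp only [h]
      rw [intervalIntegral.integral_sub ((continuous_tailIntegral (hint f)).intervalIntegrable _ _)
        ((continuous_tailIntegral (hint g)).intervalIntegrable _ _), hT, hT]
      ring
    rw [Real.dist_eq, hsub]
    have := hbd (fun t => f t - g t) (dist f g)
      (fun t => (Real.dist_eq _ _).symm.trans_le (BoundedContinuousFunction.dist_coe_le_dist t)) x
    simpa using this
  have hfix := hcontr.fixedPoint_isFixedPt
  set f := ContractingWith.fixedPoint T hcontr
  have hf (x : ℝ) : f x = 1 + σ * ∫ η in (0:ℝ)..max x 0, tailIntegral (fun t => U t * f t) η := by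
    rw [← hT, hfix.eq]
  have hnorm : ‖f‖ ≤ 1 + 1 / 2 * ‖f‖ := by
    refine (BoundedContinuousFunction.norm_le (by positivity)).2 fun x => ?_
    rw [hf]
    refine (norm_add_le _ _).trans ?_
    rw [norm_one]
    exact add_le_add_right (hbd f _ f.norm_coe_le_norm x) 1
  exact ⟨f, f.continuous, fun x => (f.norm_coe_le_norm x).trans (by linarith), hf⟩

/-- Second-order expansion of `∫_0^∞ U f` when `f(x) = 1 + σ ∫_0^x ∫_η^∞ U f` on `[0, ∞)`. -/
lemma abs_tailIntegral_expansion_le {U f : ℝ → ℝ} {σ D : ℝ} (hU : Integrable U)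
    (hU1 : IntegrableOn (fun x => x * |U x|) (Set.Ioi 0)) (hf : Continuous f)
    (hf2 : ∀ x, |f x| ≤ 2)
    (hfe : ∀ x, 0 ≤ x → f x = 1 + σ * ∫ η in (0:ℝ)..x, tailIntegral (fun t => U t * f t) η)
    (hD : ∀ x, 0 ≤ x → |f x - 1| ≤ D) :
    |tailIntegral (fun t => U t * f t) 0 - tailIntegral U 0
        - σ * ∫ η in Set.Ioi (0:ℝ), tailIntegral U η ^ 2|
      ≤ |σ| * (D * tailIntegral (fun t => |U t|) 0 *
          ∫ η in Set.Ioi (0:ℝ), tailIntegral (fun t => |U t|) η) := by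
  set w := tailIntegral fun t => |U t| with hw
  have hD0 : 0 ≤ D := (abs_nonneg _).trans (hD 0 le_rfl)
  have hUf := hf.integrable_mul_of_bounded hU hf2
  set g := tailIntegral fun t => U t * f t with hg
  have hgc : Continuous g := continuous_tailIntegral hUf
  have hwi : IntegrableOn w (Set.Ioi 0) :=
    integrableOn_tailIntegral hU.abs (by simpa using hU1)
  have hti : IntegrableOn (tailIntegral U) (Set.Ioi 0) := integrableOn_tailIntegral hU hU1
  have hw0 (η : ℝ) (hη : 0 ≤ η) : w η ≤ w 0 := tailIntegral_abs_antitone hU hη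
  have hgb (η : ℝ) (hη : 0 ≤ η) : |g η| ≤ 2 * w 0 :=
    (abs_tailIntegral_mul_le hU (fun t _ => hf2 t) hη).trans (by linarith [hw0 η hη])
  have htb (η : ℝ) (hη : 0 ≤ η) : |tailIntegral U η| ≤ w η := by
    simpa using abs_tailIntegral_mul_le (φ := fun _ => 1) (c := 1) hU (by simp) hη
  have hdiff (η : ℝ) : g η - tailIntegral U η = tailIntegral (fun t => U t * (f t - 1)) η := by
    simp only [hg, tailIntegral, mul_sub, mul_one]
    exact (integral_sub hUf.integrableOn hU.integrableOn).symm
  have hfirst : g 0 - tailIntegral U 0 = σ * ∫ η in Set.Ioi (0:ℝ), tailIntegral U η * g η := by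
    rw [hdiff, ← integral_mul_primitive hU hU1 hgc hgb, ← integral_const_mul]
    refine setIntegral_congr_fun measurableSet_Ioi fun x hx => ?_
    rw [hfe x (le_of_lt hx)]
    ring
  have hbd {φ : ℝ → ℝ} (hφ : Continuous φ) {c : ℝ} (hc : ∀ η, 0 ≤ η → |φ η| ≤ c) :
      IntegrableOn (fun η => tailIntegral U η * φ η) (Set.Ioi 0) := by
    refine hti.mul_bdd (c := c) hφ.aestronglyMeasurable ?_
    filter_upwards [ae_restrict_mem measurableSet_Ioi] with η hη
    exact hc η (le_of_lt hη)
  have hsub : (∫ η in Set.Ioi (0:ℝ), tailIntegral U η * g η)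
      - ∫ η in Set.Ioi (0:ℝ), tailIntegral U η ^ 2
      = ∫ η in Set.Ioi (0:ℝ), tailIntegral U η * (g η - tailIntegral U η) := by
    simp only [mul_sub, pow_two]
    exact (integral_sub (hbd hgc hgb) (hbd (continuous_tailIntegral hU)
      fun η hη => (htb η hη).trans (hw0 η hη))).symm
  rw [hfirst, ← mul_sub, hsub, abs_mul]
  refine mul_le_mul_of_nonneg_left ?_ (abs_nonneg _)
  rw [← integral_const_mul, ← Real.norm_eq_abs]
  refine norm_integral_le_of_norm_le (hwi.const_mul _) ?_
  filter_upwards [ae_restrict_mem measurableSet_Ioi] with η hη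
  have hη' : 0 ≤ η := le_of_lt hη
  have h1 : |g η - tailIntegral U η| ≤ D * w 0 := by
    rw [hdiff]
    exact (abs_tailIntegral_mul_le hU hD hη').trans
      (mul_le_mul_of_nonneg_left (hw0 η hη') hD0)
  rw [norm_mul, mul_comm]
  exact mul_le_mul h1 (htb η hη') (abs_nonneg _) ((abs_nonneg _).trans h1)

/-- Lemma 3.5 (first part): for `V` with `∫_0^∞ (1+ξ)|V(ξ)| dξ < ∞` there are
`σ₀ > 0`, `C > 0` such that for `|σ| ≤ σ₀` the half-line equation `ψ'' + σVψ = 0`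
has a solution `ψ₁` (with continuous derivative `ψd` on `[0,∞)`, locally absolutely
continuous via the integral identity) with `ψ₁(0) = 1`, `ψ₁ = 1 + O(σ)`,
`ψ₁' = O(σ)` uniformly on `[0,∞)`, and
`ψ₁'(0) = σb + σ²c² + O(σ³)` where `b = ∫_0^∞ V` and `c² = ∫_0^∞ (∫_η^∞ V)² dη`. -/
theorem half_line_bounded_solution (V : ℝ → ℝ)
    (hVmeas : Measurable V)
    (hVint : IntegrableOn (fun ξ => (1 + ξ) * |V ξ|) (Set.Ici 0)) :
    ∃ σ₀ : ℝ, 0 < σ₀ ∧ ∃ C : ℝ, 0 < C ∧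
      ∀ σ : ℝ, |σ| ≤ σ₀ →
        ∃ ψ ψd : ℝ → ℝ,
          ContinuousOn ψd (Set.Ici 0) ∧
          (∀ x ∈ Set.Ici (0:ℝ), HasDerivWithinAt ψ (ψd x) (Set.Ici 0) x) ∧
          (∀ x ∈ Set.Ici (0:ℝ), ψd x = ψd 0 - σ * ∫ t in (0:ℝ)..x, V t * ψ t) ∧
          ψ 0 = 1 ∧
          (∀ x ∈ Set.Ici (0:ℝ), |ψ x - 1| ≤ C * |σ|) ∧
          (∀ x ∈ Set.Ici (0:ℝ), |ψd x| ≤ C * |σ|) ∧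
          |ψd 0 - σ * (∫ ξ in Set.Ici (0:ℝ), V ξ)
              - σ ^ 2 * (∫ η in Set.Ici (0:ℝ), (∫ ξ in Set.Ici η, V ξ) ^ 2)|
            ≤ C * |σ| ^ 3 := by
  set U : ℝ → ℝ := Set.indicator (Set.Ici 0) V with hUdef
  have hUV {x : ℝ} (hx : 0 ≤ x) : U x = V x := Set.indicator_of_mem hx V
  have hVi : IntegrableOn V (Set.Ici 0) := by
    refine hVint.mono' hVmeas.aestronglyMeasurable ?_
    filter_upwards [ae_restrict_mem measurableSet_Ici] with x hx
    rw [Real.norm_eq_abs]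
    nlinarith [mul_nonneg (Set.mem_Ici.1 hx) (abs_nonneg (V x))]
  have hU : Integrable U := (integrable_indicator_iff measurableSet_Ici).2 hVi
  have hU1 : IntegrableOn (fun x => x * |U x|) (Set.Ioi 0) := by
    refine IntegrableOn.congr_fun ((hVint.sub hVi.abs).mono_set Set.Ioi_subset_Ici_self)
      (fun x hx => ?_) measurableSet_Ioi
    simp only [Pi.sub_apply, hUV (le_of_lt (Set.mem_Ioi.1 hx))]
    ring
  have htail {η : ℝ} (hη : 0 ≤ η) : ∫ ξ in Set.Ici η, V ξ = tailIntegral U η := by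
    rw [integral_Ici_eq_integral_Ioi]
    exact setIntegral_congr_fun measurableSet_Ioi fun x hx => (hUV (hη.trans (le_of_lt hx))).symm
  have hsq : ∫ η in Set.Ici (0:ℝ), (∫ ξ in Set.Ici η, V ξ) ^ 2
      = ∫ η in Set.Ioi (0:ℝ), tailIntegral U η ^ 2 := by
    rw [integral_Ici_eq_integral_Ioi]
    refine setIntegral_congr_fun measurableSet_Ioi fun η hη => ?_
    simp only [htail (le_of_lt (Set.mem_Ioi.1 hη))]
  rw [htail le_rfl, hsq]
  set M := ∫ η in Set.Ioi (0:ℝ), tailIntegral (fun t => |U t|) η with hM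
  have hM0 : 0 ≤ M := integral_nonneg fun η => tailIntegral_abs_nonneg U η
  set B := tailIntegral (fun t => |U t|) 0 with hB
  have hB0 : 0 ≤ B := tailIntegral_abs_nonneg U 0
  have hMB : 0 ≤ 2 * M * B * M := by positivity
  refine ⟨1 / (2 * (M + 1)), by positivity, 2 * M + 2 * B + 2 * M * B * M + 1, by positivity,
    fun σ hσ => ?_⟩
  have hσM : |σ| * M ≤ 1 / 2 := by
    calc |σ| * M ≤ 1 / (2 * (M + 1)) * (M + 1) :=
          mul_le_mul hσ (by linarith) hM0 (by positivity)
      _ = 1 / 2 := by field_simp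
  obtain ⟨f, hfc, hf2, hf⟩ := exists_bounded_fixedPoint hU hU1 hσM
  have hUf := hfc.integrable_mul_of_bounded hU hf2
  set g := tailIntegral fun t => U t * f t with hg
  have hgc : Continuous g := continuous_tailIntegral hUf
  have hfx {x : ℝ} (hx : 0 ≤ x) : f x = 1 + σ * ∫ η in (0:ℝ)..x, g η := by
    rw [hf, max_eq_left hx]
  have hf1 (x : ℝ) (hx : 0 ≤ x) : |f x - 1| ≤ 2 * M * |σ| := by
    rw [hfx hx, add_sub_cancel_left, abs_mul]
    have := mul_le_mul_of_nonneg_left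
      (abs_integral_tailIntegral_mul_le hU hU1 (fun t _ => hf2 t) hx) (abs_nonneg σ)
    linarith
  have hexp := abs_tailIntegral_expansion_le hU hU1 hfc hf2 (fun x hx => hfx hx) hf1
  refine ⟨fun x => 1 + σ * ∫ η in (0:ℝ)..x, g η, fun x => σ * g x,
    (continuous_const.mul hgc).continuousOn, fun x _ => ?_, fun x hx => ?_, by simp,
    fun x hx => ?_, fun x hx => ?_, ?_⟩
  · exact (((hgc.integral_hasStrictDerivAt 0 x).hasDerivAt.const_mul σ).const_add 1).hasDerivWithinAt
  · simp only
    rw [hg, tailIntegral_eq_sub hUf x, mul_sub]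
    congr 2
    refine intervalIntegral.integral_congr fun t ht => ?_
    rw [Set.uIcc_of_le hx] at ht
    simp only [hUV ht.1, ← hfx ht.1, ← hg]
  · simp only [← hfx hx]
    refine (hf1 x hx).trans (mul_le_mul_of_nonneg_right ?_ (abs_nonneg _))
    linarith
  · have h1 : |g x| ≤ 2 * B := (abs_tailIntegral_mul_le hU (fun t _ => hf2 t) hx).trans
      (mul_le_mul_of_nonneg_left (tailIntegral_abs_antitone hU hx) two_pos.le)
    rw [abs_mul, mul_comm]
    refine mul_le_mul_of_nonneg_right ?_ (abs_nonneg _)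
    linarith
  · have heq : σ * g 0 - σ * tailIntegral U 0
          - σ ^ 2 * ∫ η in Set.Ioi (0:ℝ), tailIntegral U η ^ 2
        = σ * (g 0 - tailIntegral U 0 - σ * ∫ η in Set.Ioi (0:ℝ), tailIntegral U η ^ 2) := by
      ring
    rw [heq, abs_mul]
    calc _ ≤ |σ| * (|σ| * (2 * M * |σ| * B * M)) :=
          mul_le_mul_of_nonneg_left hexp (abs_nonneg _)
      _ = 2 * M * B * M * |σ| ^ 3 := by ring
      _ ≤ _ := mul_le_mul_of_nonneg_right (by linarith) (by positivity)
end

section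
/- Let V : [0,∞) → ℝ be measurable with ∫_0^∞ (1 + ξ)|V(ξ)| dξ < ∞. Then there exist σ₀ > 0 and C > 0 such that for every σ with |σ| ≤ σ₀ there is a function ψ₂ on [0,∞), continuously differentiable with ψ₂′ locally absolutely continuous, solving ψ₂″(x) + σV(x)ψ₂(x) = 0 for almost every x ≥ 0, with ψ₂(0) = 0, ψ₂′(0) = 1, sup_{x>0} |ψ₂(x)/x − 1| ≤ C|σ|, and sup_{x≥0} |ψ₂′(x) − 1| ≤ C|σ|. -/
open MeasureTheory

open scoped BoundedContinuousFunction in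
/-- The primitive of a bounded function grows at most linearly. -/
theorem abs_integral_le_norm_mul_abs (g : ℝ →ᵇ ℝ) (t : ℝ) :
    |∫ s in (0:ℝ)..t, g s| ≤ ‖g‖ * |t| := by
  simpa using intervalIntegral.norm_integral_le_of_norm_le_const
    (fun s (_ : s ∈ Set.uIoc 0 t) => g.norm_coe_le_norm s)

open scoped BoundedContinuousFunction in
theorem integrable_mul_primitive {W : ℝ → ℝ} (hW : Measurable W)
    (hint : Integrable fun t => |W t| * |t|) (g : ℝ →ᵇ ℝ) :
    Integrable fun t => W t * ∫ s in (0:ℝ)..t, g s := by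
  have hcont : Continuous fun t => ∫ s in (0:ℝ)..t, g s :=
    intervalIntegral.continuous_primitive (fun a b => g.continuous.intervalIntegrable a b) 0
  refine (hint.const_mul ‖g‖).mono' (hW.mul hcont.measurable).aestronglyMeasurable
    (.of_forall fun t => ?_)
  rw [Real.norm_eq_abs, abs_mul]
  calc |W t| * |∫ s in (0:ℝ)..t, g s| ≤ |W t| * (‖g‖ * |t|) := by
        gcongr; exact abs_integral_le_norm_mul_abs g t
    _ = ‖g‖ * (|W t| * |t|) := by ring

open scoped BoundedContinuousFunction in
theorem abs_integral_mul_primitive_le {W : ℝ → ℝ} (hint : Integrable fun t => |W t| * |t|)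
    (g : ℝ →ᵇ ℝ) (x : ℝ) :
    |∫ t in (0:ℝ)..x, W t * ∫ s in (0:ℝ)..t, g s| ≤ (∫ t, |W t| * |t|) * ‖g‖ := by
  rw [intervalIntegral.abs_integral_eq_abs_integral_uIoc, ← Real.norm_eq_abs]
  calc _ ≤ ∫ t in Set.uIoc 0 x, ‖g‖ * (|W t| * |t|) := by
        refine norm_integral_le_of_norm_le (hint.const_mul _).integrableOn
          (.of_forall fun t => ?_)
        rw [Real.norm_eq_abs, abs_mul]
        calc |W t| * |∫ s in (0:ℝ)..t, g s| ≤ |W t| * (‖g‖ * |t|) := by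
              gcongr; exact abs_integral_le_norm_mul_abs g t
          _ = ‖g‖ * (|W t| * |t|) := by ring
    _ ≤ ∫ t, ‖g‖ * (|W t| * |t|) :=
        setIntegral_le_integral (hint.const_mul _) (.of_forall fun t => by positivity)
    _ = _ := by rw [integral_const_mul, mul_comm]

open scoped BoundedContinuousFunction in
/-- The Volterra equation `g = 1 - σ ∫₀ˣ W ∫₀ᵗ g` has a bounded continuous solution when
`|σ| ∫ |t W(t)| dt ≤ 1/2`. -/
theorem exists_bounded_solution_volterra {W : ℝ → ℝ} (hW : Measurable W)
    (hint : Integrable fun t => |W t| * |t|) {σ : ℝ}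
    (hσ : |σ| * ∫ t, |W t| * |t| ≤ 1 / 2) :
    ∃ g : ℝ →ᵇ ℝ, (∀ x, g x = 1 - σ * ∫ t in (0:ℝ)..x, W t * ∫ s in (0:ℝ)..t, g s) ∧
      ‖g‖ ≤ 2 := by
  have hcont (g : ℝ →ᵇ ℝ) :
      Continuous fun x => 1 - σ * ∫ t in (0:ℝ)..x, W t * ∫ s in (0:ℝ)..t, g s :=
    continuous_const.sub <| continuous_const.mul <| intervalIntegral.continuous_primitive
      (fun _ _ => (integrable_mul_primitive hW hint g).intervalIntegrable) 0
  have hbound (g : ℝ →ᵇ ℝ) (x : ℝ) :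
      |σ * ∫ t in (0:ℝ)..x, W t * ∫ s in (0:ℝ)..t, g s| ≤ 1 / 2 * ‖g‖ := by
    rw [abs_mul]
    calc _ ≤ |σ| * ((∫ t, |W t| * |t|) * ‖g‖) := by
          gcongr; exact abs_integral_mul_primitive_le hint g x
      _ = (|σ| * ∫ t, |W t| * |t|) * ‖g‖ := by ring
      _ ≤ _ := by gcongr
  have hnorm (g : ℝ →ᵇ ℝ) (x : ℝ) :
      ‖1 - σ * ∫ t in (0:ℝ)..x, W t * ∫ s in (0:ℝ)..t, g s‖ ≤ 1 + 1 / 2 * ‖g‖ :=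
    (norm_sub_le _ _).trans (add_le_add (by simp) (hbound g x))
  let T (g : ℝ →ᵇ ℝ) : ℝ →ᵇ ℝ :=
    BoundedContinuousFunction.ofNormedAddCommGroup _ (hcont g) _ (hnorm g)
  have hT_apply (g : ℝ →ᵇ ℝ) (x : ℝ) :
      T g x = 1 - σ * ∫ t in (0:ℝ)..x, W t * ∫ s in (0:ℝ)..t, g s := rfl
  have hT : ContractingWith (1 / 2) T := by
    refine ⟨by rw [← NNReal.coe_lt_coe]; norm_num, LipschitzWith.of_dist_le_mul fun f g => ?_⟩
    refine (BoundedContinuousFunction.dist_le (by positivity)).2 fun x => ?_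
    have hsub : T f x - T g x =
        -(σ * ∫ t in (0:ℝ)..x, W t * ∫ s in (0:ℝ)..t, (f - g) s) := by
      have hprim (t : ℝ) : W t * ∫ s in (0:ℝ)..t, (f - g) s =
          W t * (∫ s in (0:ℝ)..t, f s) - W t * ∫ s in (0:ℝ)..t, g s := by
        rw [← mul_sub, ← intervalIntegral.integral_sub (f.continuous.intervalIntegrable _ _)
          (g.continuous.intervalIntegrable _ _)]
        rfl
      simp_rw [hprim]
      rw [intervalIntegral.integral_sub (integrable_mul_primitive hW hint f).intervalIntegrable
        (integrable_mul_primitive hW hint g).intervalIntegrable]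
      rw [hT_apply, hT_apply]
      ring
    rw [Real.dist_eq, hsub, abs_neg, dist_eq_norm]
    simpa using hbound (f - g) x
  have hfix : T hT.fixedPoint = hT.fixedPoint := hT.fixedPoint_isFixedPt
  refine ⟨hT.fixedPoint, fun x => (DFunLike.congr_fun hfix x).symm, ?_⟩
  have hle : ‖T hT.fixedPoint‖ ≤ 1 + 1 / 2 * ‖hT.fixedPoint‖ :=
    (BoundedContinuousFunction.norm_le (by positivity)).2 (hnorm _)
  rw [hfix] at hle
  linarith

/-- Lemma 3.5 (second part): for `V` with `∫_0^∞ (1+ξ)|V(ξ)| dξ < ∞` there are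
`σ₀ > 0`, `C > 0` such that for `|σ| ≤ σ₀` the half-line equation `ψ'' + σVψ = 0`
has a solution `ψ₂` (with continuous derivative `ψd` on `[0,∞)`, locally absolutely
continuous via the integral identity) with `ψ₂(0) = 0`, `ψ₂'(0) = 1`,
`ψ₂(x) = x(1 + O(σ))` and `ψ₂'(x) = 1 + O(σ)` uniformly on `[0,∞)`. -/
theorem half_line_growing_solution (V : ℝ → ℝ)
    (hVmeas : Measurable V)
    (hVint : IntegrableOn (fun ξ => (1 + ξ) * |V ξ|) (Set.Ici 0)) :
    ∃ σ₀ : ℝ, 0 < σ₀ ∧ ∃ C : ℝ, 0 < C ∧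
      ∀ σ : ℝ, |σ| ≤ σ₀ →
        ∃ ψ ψd : ℝ → ℝ,
          ContinuousOn ψd (Set.Ici 0) ∧
          (∀ x ∈ Set.Ici (0:ℝ), HasDerivWithinAt ψ (ψd x) (Set.Ici 0) x) ∧
          (∀ x ∈ Set.Ici (0:ℝ), ψd x = ψd 0 - σ * ∫ t in (0:ℝ)..x, V t * ψ t) ∧
          ψ 0 = 0 ∧ ψd 0 = 1 ∧
          (∀ x : ℝ, 0 < x → |ψ x / x - 1| ≤ C * |σ|) ∧
          (∀ x ∈ Set.Ici (0:ℝ), |ψd x - 1| ≤ C * |σ|) := by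
  let W : ℝ → ℝ := (Set.Ici 0).indicator V
  have hW : Measurable W := hVmeas.indicator measurableSet_Ici
  have hint : Integrable fun t => |W t| * |t| := by
    refine (hVint.integrable_indicator measurableSet_Ici).mono'
      (by fun_prop) (.of_forall fun t => ?_)
    by_cases ht : t ∈ Set.Ici (0:ℝ)
    · have ht0 : 0 ≤ t := ht
      simp only [W, Set.indicator_of_mem ht, norm_mul, Real.norm_eq_abs, abs_abs,
        abs_of_nonneg ht0]
      nlinarith [abs_nonneg (V t)]
    · simp [W, Set.indicator_of_notMem ht]
  set M := ∫ t, |W t| * |t| with hM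
  have hM0 : 0 ≤ M := integral_nonneg fun t => by positivity
  refine ⟨1 / (2 * (M + 1)), by positivity, 2 * (M + 1), by positivity, fun σ hσ => ?_⟩
  have hσM : |σ| * M ≤ 1 / 2 := by
    rw [le_div_iff₀ (by positivity)] at hσ
    nlinarith [abs_nonneg σ]
  obtain ⟨g, hg, hg2⟩ := exists_bounded_solution_volterra hW hint hσM
  have hg1 (x : ℝ) : |g x - 1| ≤ 2 * (M + 1) * |σ| := by
    rw [hg x, sub_sub_cancel_left, abs_neg, abs_mul]
    calc _ ≤ |σ| * (M * ‖g‖) := by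
          gcongr; exact abs_integral_mul_primitive_le hint g x
      _ ≤ |σ| * ((M + 1) * 2) := by gcongr; linarith
      _ = _ := by ring
  have hg0 : g 0 = 1 := by rw [hg 0]; simp
  refine ⟨fun x => ∫ s in (0:ℝ)..x, g s, g, g.continuous.continuousOn,
    fun x _ => (g.continuous.integral_hasStrictDerivAt 0 x).hasDerivAt.hasDerivWithinAt,
    fun x hx => ?_, by simp, hg0, fun x hx => ?_, fun x _ => hg1 x⟩
  · rw [hg0, hg x]
    congr 2
    refine intervalIntegral.integral_congr fun t ht => ?_
    rw [Set.uIcc_of_le hx] at ht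
    simp [W, Set.indicator_of_mem (show t ∈ Set.Ici (0:ℝ) from ht.1)]
  · have hsub : (∫ s in (0:ℝ)..x, g s) / x - 1 = (∫ s in (0:ℝ)..x, (g s - 1)) / x := by
      rw [intervalIntegral.integral_sub (g.continuous.intervalIntegrable _ _)
        intervalIntegrable_const]
      field_simp
      simp
    rw [hsub, abs_div, abs_of_pos hx, div_le_iff₀ hx]
    simpa [abs_of_pos hx] using intervalIntegral.norm_integral_le_of_norm_le_const
      (f := fun s => g s - 1) (fun s (_ : s ∈ Set.uIoc 0 x) => hg1 s)
end
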